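/- arXiv:2012.06467 — 12 statements merged into one kernel-verified Lean document; each statement's English description precedes it below -/
import Mathlib

section
/- Let C be an [n,k] linear code over F_q with k < n. Then: (i) t ≤ R_t(C) for every 1 ≤ t ≤ n−k; (ii) R_t(C) ≤ R_{t+1}(C) for every t ≥ 1; and (iii) R_t(C) = n−k for every t ≥ n−k. -/
noncomputable section

/-- The `t`-weight of a `t × n` matrix over `F`: the number of nonzero columns. -/
def twt {F : Type*} [Field F] {t n : ℕ} (v : Matrix (Fin t) (Fin n) F) : ℕ :=
  Set.ncard {j : Fin n | ∃ i : Fin t, v i j ≠ 0}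

/-- The `t`-ball of radius `r` centered at `v`, with respect to the `t`-distance
`d⁽ᵗ⁾(v, v') = twt (v - v')`. -/
def tBall {F : Type*} [Field F] {t n : ℕ} (r : ℕ) (v : Matrix (Fin t) (Fin n) F) :
    Set (Matrix (Fin t) (Fin n) F) :=
  {v' | twt (v' - v) ≤ r}

/-- The `t`-th generalized covering radius of a code `C ⊆ F^n`: the least `r` such that
the `t`-balls of radius `r` centered at the elements of `C^t` cover `F^{t×n}`. -/
def genCovRad {F : Type*} [Field F] {n : ℕ} (C : Set (Fin n → F)) (t : ℕ) : ℕ :=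
  sInf {r : ℕ | ∀ v : Matrix (Fin t) (Fin n) F,
    ∃ c : Matrix (Fin t) (Fin n) F, (∀ i, c i ∈ C) ∧ v ∈ tBall r c}


def covSet {F : Type*} [Field F] {n : ℕ} (C : Set (Fin n → F)) (t : ℕ) : Set ℕ :=
  {r : ℕ | ∀ v : Matrix (Fin t) (Fin n) F,
    ∃ c : Matrix (Fin t) (Fin n) F, (∀ i, c i ∈ C) ∧ v ∈ tBall r c}

lemma codim_mem {F : Type*} [Field F] {n k : ℕ} 
    (C : Submodule F (Fin n → F)) (hC : Module.finrank F C = k) (t : ℕ) :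
    n - k ∈ covSet (C : Set (Fin n → F)) t := by
  have hq : Module.finrank F ((Fin n → F) ⧸ C) = n - k := by
    have := C.finrank_quotient_add_finrank
    simp at this
    omega
  set s : Set ((Fin n → F) ⧸ C) := Set.range (fun j : Fin n => C.mkQ (Pi.single j (1:F))) with hs
  have hspan : Submodule.span F s = ⊤ := by
    have h1 : s = C.mkQ '' (Set.range (fun j : Fin n => (Pi.single j (1:F) : Fin n → F))) := by
      rw [hs, ← Set.range_comp]; rfl
    have h2 := (Pi.basisFun F (Fin n)).span_eq
    have h3 : (Set.range (fun j : Fin n => (Pi.single j (1:F) : Fin n → F)))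
        = Set.range (Pi.basisFun F (Fin n)) := by
      congr 1; ext j; simp
    rw [h1, Submodule.span_image, h3, h2, Submodule.map_top, Submodule.range_mkQ]
  obtain ⟨f, hf, hfs, -⟩ := Submodule.exists_fun_fin_finrank_span_eq F s
  choose g hg using hf
  have hx : ∀ x : Fin n → F, ∃ c ∈ C, ∀ j, j ∉ Set.range g → (x - c) j = 0 := by
    intro x
    have hm : C.mkQ x ∈ Submodule.span F (Set.range f) := by
      rw [hfs, hspan]; trivial
    rw [Submodule.mem_span_range_iff_exists_fun] at hm
    obtain ⟨a, ha⟩ := hm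
    refine ⟨x - ∑ i, a i • Pi.single (g i) (1:F), ?_, ?_⟩
    · rw [← Submodule.Quotient.mk_eq_zero, ← Submodule.mkQ_apply, map_sub, map_sum, ← ha,
        sub_eq_zero]
      refine Finset.sum_congr rfl fun i _ => ?_
      rw [map_smul, ← hg i]
    · intro j hj
      simp only [sub_sub_cancel, Finset.sum_apply, Pi.smul_apply]
      refine Finset.sum_eq_zero fun i _ => ?_
      have : j ≠ g i := fun h => hj ⟨i, h.symm⟩
      simp [this]
  intro v
  choose c hc hc' using hx
  refine ⟨fun i => c (v i), fun i => hc _, ?_⟩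
  change Set.ncard _ ≤ _
  calc _ ≤ (Set.range g).ncard := by
        refine Set.ncard_le_ncard ?_ (Set.toFinite _)
        rintro j ⟨i, hi⟩
        by_contra h
        exact hi (hc' (v i) j h)
    _ ≤ n - k := by
        rw [← Set.image_univ]
        refine (Set.ncard_image_le (Set.toFinite _)).trans ?_
        rw [Set.ncard_univ, Nat.card_eq_fintype_card, Fintype.card_fin, hspan, finrank_top, hq]

lemma le_of_mem {F : Type*} [Field F] {n k : ℕ} 
    (C : Submodule F (Fin n → F)) (hC : Module.finrank F C = k) (t : ℕ) (ht : t ≤ n - k)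
    (r : ℕ) (hr : r ∈ covSet (C : Set (Fin n → F)) t) : t ≤ r := by
  have hq : Module.finrank F ((Fin n → F) ⧸ C) = n - k := by
    have := C.finrank_quotient_add_finrank
    simp at this
    omega
  let b := Module.finBasisOfFinrankEq F _ hq
  have hb : LinearIndependent F (fun i : Fin t => b (Fin.castLE ht i)) :=
    b.linearIndependent.comp _ (Fin.castLE_injective ht)
  choose v hv using fun i : Fin t => C.mkQ_surjective (b (Fin.castLE ht i))
  obtain ⟨c, hc, hvc⟩ := hr v
  change Set.ncard _ ≤ r at hvc
  set S : Set (Fin n) := {j | ∃ i : Fin t, v i j - c i j ≠ 0} with hS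
  have hli : LinearIndependent F (fun (i : Fin t) (j : S) => v i j - c i j) := by
    rw [Fintype.linearIndependent_iff] at hb ⊢
    intro a ha
    apply hb
    have h0 : ∑ i, a i • (v i - c i) = 0 := by
      ext j
      by_cases hj : j ∈ S
      · have := congrFun ha ⟨j, hj⟩
        simpa [Finset.sum_apply] using this
      · simp only [Finset.sum_apply, Pi.smul_apply, Pi.zero_apply]
        refine Finset.sum_eq_zero fun i _ => ?_
        have : v i j - c i j = 0 := by
          by_contra h
          exact hj ⟨i, h⟩
        simp [this]
    have h1 := congrArg C.mkQ h0
    rw [map_sum, map_zero] at h1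
    rw [← h1]
    refine Finset.sum_congr rfl fun i _ => ?_
    have h2 : C.mkQ (c i) = 0 := by simpa using hc i
    rw [map_smul, map_sub, h2, hv, sub_zero]
  have := hli.fintype_card_le_finrank
  classical
  rw [Module.finrank_fintype_fun_eq_card, Fintype.card_fin, ← Nat.card_eq_fintype_card] at this
  exact this.trans hvc

lemma covSet_succ {F : Type*} [Field F] {n : ℕ} 
    (C : Set (Fin n → F)) (t r : ℕ) (hr : r ∈ covSet C (t+1)) : r ∈ covSet C t := by
  intro v
  obtain ⟨c, hc, hvc⟩ := hr (Fin.cons 0 v : Fin (t+1) → Fin n → F)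
  refine ⟨fun i => c i.succ, fun i => hc _, ?_⟩
  change Set.ncard _ ≤ r at hvc
  change Set.ncard _ ≤ r
  refine le_trans ?_ hvc
  refine Set.ncard_le_ncard ?_ (Set.toFinite _)
  rintro j ⟨i, hi⟩
  exact ⟨i.succ, hi⟩

theorem stmt1 {F : Type*} [Field F] [Fintype F] {n k : ℕ} (hkn : k < n)
    (C : Submodule F (Fin n → F)) (hC : Module.finrank F C = k) :
    (∀ t : ℕ, 1 ≤ t → t ≤ n - k → t ≤ genCovRad (C : Set (Fin n → F)) t) ∧
    (∀ t : ℕ, 1 ≤ t →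
      genCovRad (C : Set (Fin n → F)) t ≤ genCovRad (C : Set (Fin n → F)) (t + 1)) ∧
    (∀ t : ℕ, n - k ≤ t → genCovRad (C : Set (Fin n → F)) t = n - k) := by
  have hne : ∀ t, (covSet (C : Set (Fin n → F)) t).Nonempty := fun t => ⟨_, codim_mem C hC t⟩
  have h1 : ∀ t : ℕ, t ≤ n - k → t ≤ genCovRad (C : Set (Fin n → F)) t := fun t ht =>
    le_of_mem C hC t ht _ (Nat.sInf_mem (hne t))
  have h2 : ∀ t : ℕ,
      genCovRad (C : Set (Fin n → F)) t ≤ genCovRad (C : Set (Fin n → F)) (t + 1) := fun t =>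
    Nat.sInf_le (covSet_succ _ t _ (Nat.sInf_mem (hne (t+1))))
  refine ⟨fun t _ => h1 t, fun t _ => h2 t, fun t ht => le_antisymm ?_ ?_⟩
  · exact Nat.sInf_le (codim_mem C hC t)
  · exact (h1 _ le_rfl).trans (monotone_nat_of_le_succ h2 ht)
end
end

section
/- Let C be an [n,k] linear code over F_q with full-rank parity-check matrix H ∈ F_q^{(n−k)×n} (so C = ker H), and let 1 ≤ t ≤ q^{n−k}. Then the following two quantities are equal: (a) max over all t-element subsets S ⊆ F_q^{n−k} of min{|I| : I ⊆ [n], S ⊆ ⟨H_I⟩}; and (b) the minimal integer r such that for every v_1,…,v_t ∈ F_q^n there exist codewords c_1,…,c_t ∈ C and a set I ⊆ [n] with |I| = r such that supp(v_i − c_i) ⊆ I for all i ∈ [t]. -/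
noncomputable section

/-- The span of the columns of `H` indexed by `I`. -/
def colSpan {F : Type*} [Field F] {m n : ℕ} (H : Matrix (Fin m) (Fin n) F)
    (I : Finset (Fin n)) : Submodule F (Fin m → F) :=
  Submodule.span F ((fun j => fun i => H i j) '' (I : Set (Fin n)))

/-- The `t`-th generalized covering radius of a (parity-check) matrix `H`:
the maximum, over all `t`-element subsets `S` of `F^m`, of the minimal cardinality of a
set `I` of column indices such that `S ⊆ ⟨H_I⟩`. -/
def RtH {F : Type*} [Field F] [Fintype F] {m n : ℕ} (H : Matrix (Fin m) (Fin n) F)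
    (t : ℕ) : ℕ :=
  sSup { r : ℕ | ∃ S : Finset (Fin m → F), S.card = t ∧
    r = sInf { s : ℕ | ∃ I : Finset (Fin n), I.card = s ∧ ∀ x ∈ S, x ∈ colSpan H I } }

/-- The `t`-th generalized covering radius of a code `C ⊆ F^n`, cube version:
the minimal `r` such that for every `t`-tuple of vectors `v` there are codewords `c i`
and a set `I` of `r` coordinates with `supp (v i - c i) ⊆ I` for all `i`. -/
def RtCube {F : Type*} [Field F] {n : ℕ} (C : Set (Fin n → F)) (t : ℕ) : ℕ :=
  sInf { r : ℕ | ∀ v : Fin t → Fin n → F, ∃ c : Fin t → Fin n → F, ∃ I : Finset (Fin n),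
    I.card = r ∧ (∀ i, c i ∈ C) ∧ ∀ i j, v i j - c i j ≠ 0 → j ∈ I }

theorem mem_colSpan_iff {F : Type*} [Field F] {m n : ℕ} (H : Matrix (Fin m) (Fin n) F)
    (I : Finset (Fin n)) (x : Fin m → F) :
    x ∈ colSpan H I ↔ ∃ u : Fin n → F, (∀ j, u j ≠ 0 → j ∈ I) ∧ H.mulVec u = x := by
  unfold colSpan
  constructor
  · intro hx
    rw [Submodule.mem_span_image_finset_iff_exists_fun'] at hx
    obtain ⟨c, hc⟩ := hx
    refine ⟨fun j => if j ∈ I then c j else 0, fun j hj => by by_contra h; simp [h] at hj, ?_⟩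
    rw [← hc]
    ext i
    simp [Matrix.mulVec, dotProduct, Finset.sum_apply, mul_comm]
  · rintro ⟨u, hu, rfl⟩
    have : H.mulVec u = ∑ j, u j • (fun i => H i j) := by
      ext i
      simp [Matrix.mulVec, dotProduct, Finset.sum_apply, mul_comm]
    rw [this]
    refine Submodule.sum_mem _ fun j _ => ?_
    by_cases h : u j = 0
    · simp [h]
    · exact Submodule.smul_mem _ _ (Submodule.subset_span ⟨j, hu j h, rfl⟩)

theorem stmt2 {F : Type*} [Field F] [Fintype F] {n k : ℕ} (hkn : k < n)
    (H : Matrix (Fin (n - k)) (Fin n) F) (hH : H.rank = n - k)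
    {t : ℕ} (ht1 : 1 ≤ t) (ht2 : t ≤ Fintype.card F ^ (n - k)) :
    RtH H t = RtCube {x : Fin n → F | H.mulVec x = 0} t := by
  classical
  have hsurj : ∀ y : Fin (n - k) → F, ∃ v, H.mulVec v = y := by
    have : LinearMap.range H.mulVecLin = ⊤ := by
      apply Submodule.eq_top_of_finrank_eq
      rw [← Matrix.rank, hH]
      simp
    exact LinearMap.range_eq_top.mp this
  have hspan : ∀ x, x ∈ colSpan H Finset.univ := fun x => by
    obtain ⟨v, hv⟩ := hsurj x
    exact (mem_colSpan_iff _ _ _).2 ⟨v, by simp, hv⟩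
  have hle : ∀ S : Finset (Fin (n - k) → F),
      sInf { s : ℕ | ∃ I : Finset (Fin n), I.card = s ∧ ∀ x ∈ S, x ∈ colSpan H I } ≤ n :=
    fun S => Nat.sInf_le ⟨Finset.univ, by simp, fun x _ => hspan x⟩
  have hmem : RtH H t ∈ { r : ℕ | ∀ v : Fin t → Fin n → F, ∃ c : Fin t → Fin n → F,
      ∃ I : Finset (Fin n), I.card = r ∧ (∀ i, c i ∈ {x : Fin n → F | H.mulVec x = 0}) ∧
        ∀ i j, v i j - c i j ≠ 0 → j ∈ I } := by
    intro v
    obtain ⟨T, hT, hTc⟩ := Finset.exists_superset_card_eq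
      (s := Finset.univ.image fun i => H.mulVec (v i)) (n := t)
      (Finset.card_image_le.trans (by simp)) (by simpa using ht2)
    obtain ⟨I, hI, hIs⟩ := Nat.sInf_mem (s := { s : ℕ | ∃ I : Finset (Fin n), I.card = s ∧
      ∀ x ∈ T, x ∈ colSpan H I }) ⟨_, Finset.univ, rfl, fun x _ => hspan x⟩
    have h1 : I.card ≤ RtH H t := by
      rw [hI]
      refine le_csSup ⟨n, ?_⟩ ⟨T, hTc, rfl⟩
      rintro _ ⟨S, _, rfl⟩
      exact hle S
    have h2 : RtH H t ≤ n := by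
      refine csSup_le' ?_
      rintro _ ⟨S, _, rfl⟩
      exact hle S
    obtain ⟨J, hIJ, hJ⟩ := Finset.exists_superset_card_eq h1 (by simpa using h2)
    have h3 : ∀ i, ∃ u : Fin n → F, (∀ j, u j ≠ 0 → j ∈ I) ∧ H.mulVec u = H.mulVec (v i) :=
      fun i => (mem_colSpan_iff _ _ _).1
        (hIs _ (hT (Finset.mem_image_of_mem _ (Finset.mem_univ i))))
    choose u hu hu' using h3
    refine ⟨fun i => v i - u i, J, hJ, fun i => ?_, fun i j h => hIJ (hu i j ?_)⟩
    · simp [Matrix.mulVec_sub, hu']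
    · simpa using h
  apply le_antisymm
  · refine csSup_le' ?_
    rintro _ ⟨S, hS, rfl⟩
    have hm := Nat.sInf_mem ⟨_, hmem⟩
    choose w hw using hsurj
    obtain ⟨c, I, hI, hc, hs⟩ := hm (fun i => w ((S.equivFinOfCardEq hS).symm i : _))
    refine Nat.sInf_le ⟨I, hI, fun x hx => (mem_colSpan_iff _ _ _).2 ?_⟩
    have h4 := hs (S.equivFinOfCardEq hS ⟨x, hx⟩)
    have h5 : H.mulVec (c (S.equivFinOfCardEq hS ⟨x, hx⟩)) = 0 := hc _
    simp only [Equiv.symm_apply_apply] at h4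
    exact ⟨w x - c (S.equivFinOfCardEq hS ⟨x, hx⟩), h4, by
      rw [Matrix.mulVec_sub, hw, h5, sub_zero]⟩
  · exact Nat.sInf_le hmem
end
end

section
/- Let C be an [n,k] linear code over F_q with full-rank parity-check matrix H ∈ F_q^{(n−k)×n} (so C = ker H), and let 1 ≤ t ≤ q^{n−k}. Then the following two quantities are equal: (a) max over all t-element subsets S ⊆ F_q^{n−k} of min{|I| : I ⊆ [n], S ⊆ ⟨H_I⟩}; and (b) the minimal integer r such that the t-balls of radius r centered at the elements of C^t cover F_q^{t×n}, i.e., ⋃_{c ∈ C^t} B_r^{(t)}(c) = F_q^{t×n}. -/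
noncomputable section

theorem mem_colSpan_aux {F : Type*} [Field F] {m n : ℕ} (H : Matrix (Fin m) (Fin n) F)
    (I : Finset (Fin n)) (x : Fin m → F) :
    x ∈ colSpan H I ↔ ∃ e : Fin n → F, (∀ j, j ∉ I → e j = 0) ∧ H.mulVec e = x := by
  have key : ∀ e : Fin n → F, H.mulVec e = ∑ j, e j • (fun i => H i j) := by
    intro e
    ext i
    simp [Matrix.mulVec, dotProduct, Finset.sum_apply, mul_comm]
  constructor
  · intro hx
    unfold colSpan at hx
    induction hx using Submodule.span_induction with
    | mem y hy =>
      obtain ⟨j, hj, rfl⟩ := hy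
      refine ⟨Pi.single j 1, ?_, ?_⟩
      · intro l hl
        have : l ≠ j := by
          rintro rfl
          exact hl hj
        simp [this]
      · ext i
        simp
    | zero => exact ⟨0, by simp, by simp⟩
    | add y z _ _ hy hz =>
      obtain ⟨e, he, rfl⟩ := hy
      obtain ⟨f, hf, rfl⟩ := hz
      exact ⟨e + f, fun j hj => by simp [he j hj, hf j hj], Matrix.mulVec_add _ _ _⟩
    | smul a y _ hy =>
      obtain ⟨e, he, rfl⟩ := hy
      exact ⟨a • e, fun j hj => by simp [he j hj], Matrix.mulVec_smul _ _ _⟩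
  · rintro ⟨e, he, rfl⟩
    rw [key]
    refine Submodule.sum_mem _ fun j _ => ?_
    by_cases hj : j ∈ I
    · exact Submodule.smul_mem _ _ (Submodule.subset_span ⟨j, hj, rfl⟩)
    · simp [he j hj]

theorem surj_aux {F : Type*} [Field F] {m n : ℕ} (H : Matrix (Fin m) (Fin n) F)
    (hH : H.rank = m) : Function.Surjective H.mulVec := by
  have h1 : LinearMap.range H.mulVecLin = ⊤ := by
    apply Submodule.eq_top_of_finrank_eq
    simpa [Matrix.rank] using hH
  intro x
  obtain ⟨e, he⟩ := LinearMap.range_eq_top.1 h1 x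
  exact ⟨e, by simpa using he⟩

theorem stmt3 {F : Type*} [Field F] [Fintype F] {n k : ℕ} (hkn : k < n)
    (H : Matrix (Fin (n - k)) (Fin n) F) (hH : H.rank = n - k)
    {t : ℕ} (ht1 : 1 ≤ t) (ht2 : t ≤ Fintype.card F ^ (n - k)) :
    RtH H t = genCovRad {x : Fin n → F | H.mulVec x = 0} t := by
  classical
  have hs := surj_aux H hH
  have hcard : Fintype.card (Fin (n - k) → F) = Fintype.card F ^ (n - k) := by simp
  have hne : ∀ S : Finset (Fin (n - k) → F),
      n ∈ { s : ℕ | ∃ I : Finset (Fin n), I.card = s ∧ ∀ x ∈ S, x ∈ colSpan H I } := by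
    intro S
    refine ⟨Finset.univ, by simp, fun x _ => ?_⟩
    obtain ⟨e, he⟩ := hs x
    exact (mem_colSpan_aux H _ x).2 ⟨e, by simp, he⟩
  have hne2 : n ∈ {r : ℕ | ∀ v : Matrix (Fin t) (Fin n) F,
      ∃ c : Matrix (Fin t) (Fin n) F, (∀ i, c i ∈ {x : Fin n → F | H.mulVec x = 0}) ∧
        v ∈ tBall r c} := by
    intro v
    refine ⟨0, fun i => ?_, ?_⟩
    · change H.mulVec 0 = 0
      simp
    · change Set.ncard _ ≤ n
      exact (Set.ncard_le_card _).trans (by simp)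
  unfold RtH
  apply le_antisymm
  · apply csSup_le
    · obtain ⟨S, -, hS⟩ := Finset.exists_subset_card_eq
        (s := (Finset.univ : Finset (Fin (n - k) → F))) (n := t)
        (by rw [Finset.card_univ, hcard]; exact ht2)
      exact ⟨_, S, hS, rfl⟩
    · rintro r ⟨S, hS, rfl⟩
      have hmem := Nat.sInf_mem ⟨n, hne2⟩
      let f : Fin t ≃ S := (S.equivFinOfCardEq hS).symm
      choose g hg using hs
      obtain ⟨c, hc, hv⟩ := hmem (fun i => g (f i).1)
      set r := sInf {r : ℕ | ∀ v : Matrix (Fin t) (Fin n) F,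
        ∃ c : Matrix (Fin t) (Fin n) F, (∀ i, c i ∈ {x : Fin n → F | H.mulVec x = 0}) ∧
        v ∈ tBall r c} with hr
      change _ ≤ r
      let v : Matrix (Fin t) (Fin n) F := fun i => g (f i).1
      let I : Finset (Fin n) := Finset.univ.filter fun j => ∃ i : Fin t, (v - c) i j ≠ 0
      have hI : I.card ≤ r := by
        have h : twt (v - c) ≤ r := hv
        unfold twt at h
        rwa [Set.ncard_eq_toFinset_card', Set.toFinset_ofPred] at h
      refine le_trans (Nat.sInf_le ⟨I, rfl, fun x hx => ?_⟩) hI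
      obtain ⟨i, hi⟩ := f.surjective ⟨x, hx⟩
      refine (mem_colSpan_aux H _ x).2 ⟨v i - c i, ?_, ?_⟩
      · intro j hj
        by_contra h
        exact hj (Finset.mem_filter.2 ⟨Finset.mem_univ _, i, h⟩)
      · have h0 : H.mulVec (c i) = 0 := hc i
        rw [Matrix.mulVec_sub, h0, sub_zero]
        change H.mulVec (g (f i).1) = x
        rw [hg, hi]
  · apply Nat.sInf_le
    intro v
    obtain ⟨S, hS1, -, hS⟩ := Finset.exists_subsuperset_card_eq
      (s := Finset.univ.image fun i => H.mulVec (v i)) (t := Finset.univ) (n := t)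
      (Finset.subset_univ _) (Finset.card_image_le.trans (by simp))
      (by rw [Finset.card_univ, hcard]; exact ht2)
    obtain ⟨I, hI, hIS⟩ := Nat.sInf_mem ⟨n, hne S⟩
    have : ∀ i, ∃ e : Fin n → F, (∀ j, j ∉ I → e j = 0) ∧ H.mulVec e = H.mulVec (v i) :=
      fun i => (mem_colSpan_aux H I _).1
        (hIS _ (hS1 (Finset.mem_image_of_mem _ (Finset.mem_univ i))))
    choose e he1 he2 using this
    refine ⟨fun i => v i - e i, fun i => ?_, ?_⟩
    · change H.mulVec (v i - e i) = 0
      rw [Matrix.mulVec_sub, he2, sub_self]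
    · change Set.ncard _ ≤ _
      have h1 : Set.ncard {j : Fin n | ∃ i : Fin t,
          v i j - (v i j - e i j) ≠ 0} ≤ I.card := by
        rw [← Set.ncard_coe_finset]
        apply Set.ncard_le_ncard _ (Finset.finite_toSet I)
        rintro j ⟨i, hij⟩
        by_contra h
        apply hij
        have := he1 i j h
        simp [this]
      refine h1.trans ?_
      rw [hI]
      apply le_csSup
      · refine ⟨n, ?_⟩
        rintro r ⟨S, -, rfl⟩
        exact Nat.sInf_le (hne S)
      · exact ⟨S, hS, rfl⟩
end
end

section
/- Let C be an [n,k] linear code over F_q with generator matrix G ∈ F_q^{k×n} (of rank k), let t ≥ 1, and let K be a field extension of F_q of degree t (so |K| = q^t). Let C' ⊆ K^n be the K-linear code generated by the rows of G, viewed as vectors over K via the inclusion F_q ⊆ K. Then the t-th generalized covering radius of C equals the (ordinary) covering radius of C', i.e., R_t(C) = max_{x ∈ K^n} min_{c ∈ C'} d_H(x,c), where d_H denotes Hamming distance on K^n. -/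
noncomputable section

theorem aux_mem {F K : Type*} [Field F] [Field K] [Algebra F K]
    {n k t : ℕ} (b : Module.Basis (Fin t) F K) (G : Matrix (Fin k) (Fin n) F) (x : Fin n → K) :
    x ∈ Submodule.span K (Set.range fun i : Fin k => fun j : Fin n => algebraMap F K (G i j)) ↔
    ∀ l, (fun j => b.repr (x j) l) ∈ Submodule.span F (Set.range fun i : Fin k => G i) := by
  constructor
  · intro h l
    rw [Submodule.mem_span_range_iff_exists_fun] at h ⊢
    obtain ⟨a, rfl⟩ := h
    refine ⟨fun i => b.repr (a i) l, ?_⟩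
    ext j
    have h1 : (∑ i, a i • fun j : Fin n => algebraMap F K (G i j)) j = ∑ i, G i j • a i := by
      rw [Finset.sum_apply]
      refine Finset.sum_congr rfl fun i _ => ?_
      simp [Algebra.smul_def, mul_comm]
    rw [h1, Finset.sum_apply, map_sum, Finsupp.finsetSum_apply]
    refine Finset.sum_congr rfl fun i _ => ?_
    simp [mul_comm]
  · intro h
    have hx : x = ∑ l, b l • fun j => algebraMap F K (b.repr (x j) l) := by
      ext j
      rw [Finset.sum_apply]
      conv_lhs => rw [← b.sum_repr (x j)]
      refine Finset.sum_congr rfl fun i _ => ?_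
      simp [Algebra.smul_def, mul_comm]
    rw [hx]
    refine Submodule.sum_mem _ fun l _ => Submodule.smul_mem _ _ ?_
    have h2 := h l
    rw [Submodule.mem_span_range_iff_exists_fun] at h2 ⊢
    obtain ⟨a, ha⟩ := h2
    refine ⟨fun i => algebraMap F K (a i), ?_⟩
    ext j
    have h3 := congrFun ha j
    rw [Finset.sum_apply] at h3 ⊢
    rw [← h3, map_sum]
    refine Finset.sum_congr rfl fun i _ => ?_
    simp

theorem aux_dist {F K : Type*} [Field F] [Field K] [Algebra F K] [DecidableEq K]
    {n t : ℕ} (b : Module.Basis (Fin t) F K) (x y : Fin n → K) :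
    twt ((fun i j => b.repr (x j) i : Matrix (Fin t) (Fin n) F) - (fun i j => b.repr (y j) i))
      = hammingDist x y := by
  unfold twt hammingDist
  rw [← Set.ncard_coe_finset]
  congr 1
  ext j
  simp only [Set.mem_ofPred_eq, Finset.coe_filter, Finset.mem_univ, true_and]
  rw [← not_iff_not]
  push Not
  constructor
  · intro h
    apply b.repr.injective
    ext i
    exact sub_eq_zero.1 (h i)
  · intro h i
    exact sub_eq_zero.2 (by simp only [h])

theorem stmt4 {F K : Type*} [Field F] [Fintype F] [Field K] [Algebra F K] [DecidableEq K]
    {n k t : ℕ} (ht : 1 ≤ t) (hK : Module.finrank F K = t)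
    (G : Matrix (Fin k) (Fin n) F) (hG : G.rank = k)
    (C : Submodule F (Fin n → F))
    (hC : C = Submodule.span F (Set.range fun i : Fin k => G i))
    (hCk : Module.finrank F C = k)
    (C' : Submodule K (Fin n → K))
    (hC' : C' = Submodule.span K
      (Set.range fun i : Fin k => fun j : Fin n => algebraMap F K (G i j))) :
    genCovRad (C : Set (Fin n → F)) t
      = sSup { r : ℕ | ∃ x : Fin n → K,
          r = sInf { d : ℕ | ∃ c ∈ C', d = hammingDist x c } } := by
  subst hC hC'
  have : Module.Finite F K := Module.finite_of_finrank_pos (by omega)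
  let b : Module.Basis (Fin t) F K := Module.finBasisOfFinrankEq F K hK
  set C' := Submodule.span K
      (Set.range fun i : Fin k => fun j : Fin n => algebraMap F K (G i j)) with hC'
  have surj : ∀ v : Matrix (Fin t) (Fin n) F, ∃ x : Fin n → K,
      v = fun i j => b.repr (x j) i := by
    intro v
    refine ⟨fun j => b.equivFun.symm fun i => v i j, ?_⟩
    ext i j
    rw [← Module.Basis.equivFun_apply, LinearEquiv.apply_symm_apply]
  have key : ∀ r : ℕ, (∀ v : Matrix (Fin t) (Fin n) F, ∃ c : Matrix (Fin t) (Fin n) F,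
      (∀ i, c i ∈ ((Submodule.span F (Set.range fun i : Fin k => G i) :
        Submodule F (Fin n → F)) : Set (Fin n → F))) ∧ v ∈ tBall r c) ↔
      ∀ x : Fin n → K, ∃ c ∈ C', hammingDist x c ≤ r := by
    intro r
    constructor
    · intro h x
      obtain ⟨c, hc, hd⟩ := h (fun i j => b.repr (x j) i)
      obtain ⟨y, rfl⟩ := surj c
      refine ⟨y, (aux_mem b G y).2 hc, ?_⟩
      rw [← aux_dist b]
      exact hd
    · intro h v
      obtain ⟨x, rfl⟩ := surj v
      obtain ⟨y, hy, hd⟩ := h x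
      refine ⟨fun i j => b.repr (y j) i, (aux_mem b G y).1 hy, ?_⟩
      rw [← aux_dist b] at hd
      exact hd
  unfold genCovRad
  simp only [key]
  have hne : ∀ x : Fin n → K, { d : ℕ | ∃ c ∈ C', d = hammingDist x c }.Nonempty :=
    fun x => ⟨_, 0, C'.zero_mem, rfl⟩
  have hle : ∀ x : Fin n → K, ∀ c ∈ C',
      sInf { d : ℕ | ∃ c ∈ C', d = hammingDist x c } ≤ hammingDist x c :=
    fun x c hc => Nat.sInf_le ⟨c, hc, rfl⟩
  have hbd : BddAbove { r : ℕ | ∃ x : Fin n → K,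
          r = sInf { d : ℕ | ∃ c ∈ C', d = hammingDist x c } } := by
    refine ⟨n, ?_⟩
    rintro r ⟨x, rfl⟩
    refine (hle x 0 C'.zero_mem).trans ?_
    simpa using hammingDist_le_card_fintype (x := x) (y := 0)
  apply le_antisymm
  · apply Nat.sInf_le
    intro x
    obtain ⟨c, hc, hd⟩ := Nat.sInf_mem (hne x)
    refine ⟨c, hc, ?_⟩
    rw [← hd]
    exact le_csSup hbd ⟨x, rfl⟩
  · refine csSup_le ⟨_, 0, rfl⟩ ?_
    rintro r ⟨x, rfl⟩
    have hS : {r : ℕ | ∀ x : Fin n → K, ∃ c ∈ C', hammingDist x c ≤ r}.Nonempty :=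
      ⟨n, fun x => ⟨0, C'.zero_mem, by
        simpa using hammingDist_le_card_fintype (x := x) (y := 0)⟩⟩
    obtain ⟨c, hc, hd⟩ := Nat.sInf_mem hS x
    exact (hle x c hc).trans hd
end
end

section
/- For every prime power q, every t ≥ 1, and every real ρ with 0 ≤ ρ ≤ 1 − 1/q^t, the minimal asymptotic rate of codes with normalized t-th generalized covering radius at most ρ satisfies κ_t(ρ,q) ≥ 1 − H_{q^t}(ρ). -/
noncomputable section

/-- `kMin F t n r` is the smallest dimension of a linear code `C ⊆ F^n` with
`t`-th generalized covering radius at most `r`. -/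
def kMin (F : Type*) [Field F] [Fintype F] (t n r : ℕ) : ℕ :=
  sInf { k : ℕ | ∃ C : Submodule F (Fin n → F), Module.finrank F C = k ∧
    genCovRad (C : Set (Fin n → F)) t ≤ r }

/-- `kappa F t ρ` is the asymptotic minimal rate of linear codes over `F` with normalized
`t`-th generalized covering radius at most `ρ`. -/
noncomputable def kappa (F : Type*) [Field F] [Fintype F] (t : ℕ) (ρ : ℝ) : ℝ :=
  Filter.liminf (fun n : ℕ => (kMin F t n ⌊ρ * n⌋₊ : ℝ) / n) Filter.atTop

/-- The `q`-ary entropy function. -/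
noncomputable def qEnt (q : ℕ) (x : ℝ) : ℝ :=
  x * Real.logb q (q - 1) - x * Real.logb q x - (1 - x) * Real.logb q (1 - x)

open Classical in
lemma aux_twt {F : Type*} [Field F] {t n : ℕ} (v : Matrix (Fin t) (Fin n) F) (l : ℝ) :
    l ^ twt v = ∏ j : Fin n, (if (fun i => v i j) = 0 then 1 else l) := by
  rw [Finset.prod_ite]
  simp only [Finset.prod_const_one, one_mul, Finset.prod_const]
  congr 1
  unfold twt
  rw [← Set.ncard_coe_finset]
  congr 1
  ext j
  simp [funext_iff]

open Classical in
lemma aux_sum {F : Type*} [Field F] [Fintype F] {t n : ℕ} (l : ℝ) :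
    ∑ v : Matrix (Fin t) (Fin n) F, l ^ twt v
      = (1 + ((Fintype.card F : ℝ) ^ t - 1) * l) ^ n := by
  have h1 : ∑ c : Fin t → F, (if c = 0 then (1:ℝ) else l)
      = 1 + ((Fintype.card F : ℝ) ^ t - 1) * l := by
    have : ∀ c : Fin t → F, (if c = 0 then (1:ℝ) else l) = l + (if c = 0 then 1 - l else 0) := by
      intro c; split_ifs <;> ring
    simp only [this, Finset.sum_add_distrib, Finset.sum_ite_eq', Finset.sum_const]
    simp
    ring
  rw [← h1]
  have h2 := Finset.prod_univ_sum (fun _ : Fin n => (Finset.univ : Finset (Fin t → F)))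
    (fun _ c => if c = 0 then (1:ℝ) else l)
  rw [Finset.prod_const, Finset.card_univ, Fintype.card_fin] at h2
  rw [h2, Fintype.piFinset_univ]
  refine Fintype.sum_equiv (Equiv.piComm (fun (_ : Fin t) (_ : Fin n) => F)) _ _ ?_
  intro v
  refine (aux_twt (v : Matrix (Fin t) (Fin n) F) l).trans ?_
  rfl

lemma aux_cov {F : Type*} [Field F] [Fintype F] {t n r : ℕ} (C : Submodule F (Fin n → F))
    (h : genCovRad (C : Set (Fin n → F)) t ≤ r) (v : Matrix (Fin t) (Fin n) F) :
    ∃ c : Matrix (Fin t) (Fin n) F, (∀ i, c i ∈ C) ∧ twt (v - c) ≤ r := by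
  have hm := Nat.sInf_mem (s := {r : ℕ | ∀ v : Matrix (Fin t) (Fin n) F,
    ∃ c : Matrix (Fin t) (Fin n) F, (∀ i, c i ∈ (C : Set (Fin n → F))) ∧ v ∈ tBall r c})
    ⟨n, fun v => ⟨0, fun i => C.zero_mem, by
      unfold tBall twt
      simp only [Set.mem_ofPred_eq]
      refine (Set.ncard_le_ncard (Set.subset_univ _) Set.finite_univ).trans ?_
      simp [Set.ncard_univ]⟩⟩
  obtain ⟨c, hc, hv⟩ := hm v
  exact ⟨c, hc, le_trans hv h⟩

open Classical in
lemma aux_card {F : Type*} [Field F] [Fintype F] {t n r : ℕ} (C : Submodule F (Fin n → F))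
    (h : genCovRad (C : Set (Fin n → F)) t ≤ r) :
    (Fintype.card F ^ t) ^ n ≤ (Fintype.card F ^ t) ^ (Module.finrank F C) *
      (Finset.univ.filter (fun v : Matrix (Fin t) (Fin n) F => twt v ≤ r)).card := by
  have hs : Function.Surjective (fun p : (Fin t → C) ×
      {v : Matrix (Fin t) (Fin n) F // twt v ≤ r} =>
      (Matrix.of (fun i => (p.1 i : Fin n → F)) + p.2.1 : Matrix (Fin t) (Fin n) F)) := by
    intro v
    obtain ⟨c, hc, hv⟩ := aux_cov C h v
    refine ⟨(fun i => ⟨c i, hc i⟩, ⟨v - c, hv⟩), ?_⟩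
    exact add_sub_cancel c v
  have := Fintype.card_le_of_surjective _ hs
  rw [Fintype.card_prod, Fintype.card_subtype, Fintype.card_fun, Fintype.card_fin,
    Module.card_eq_pow_finrank (K := F) (V := C)] at this
  have h3 : Fintype.card (Matrix (Fin t) (Fin n) F) = (Fintype.card F ^ t) ^ n := by
    rw [← Nat.card_eq_fintype_card]
    unfold Matrix
    simp [Nat.card_eq_fintype_card, ← pow_mul, mul_comm]
  rw [h3] at this
  rwa [← pow_mul _ (Module.finrank F C), mul_comm (Module.finrank F C), pow_mul] at this

lemma aux_top {F : Type*} [Field F] [Fintype F] {t n r : ℕ} :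
    genCovRad ((⊤ : Submodule F (Fin n → F)) : Set (Fin n → F)) t ≤ r := by
  refine le_trans (Nat.sInf_le ?_) (Nat.zero_le r)
  intro v
  exact ⟨v, fun i => trivial, by simp [tBall, twt]⟩

lemma aux_kle {F : Type*} [Field F] [Fintype F] {t n r : ℕ} : kMin F t n r ≤ n :=
  Nat.sInf_le ⟨⊤, by simp, aux_top⟩

open Classical in
lemma aux_ball {F : Type*} [Field F] [Fintype F] {t n : ℕ} {ρ : ℝ} (hQ : 2 ≤ (Fintype.card F : ℝ) ^ t)
    (h0 : 0 ≤ ρ) (h1 : ρ ≤ 1 - 1 / (Fintype.card F : ℝ) ^ t) :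
    ((Finset.univ.filter
      (fun v : Matrix (Fin t) (Fin n) F => twt v ≤ ⌊ρ * n⌋₊)).card : ℝ) *
      (ρ / ((1 - ρ) * ((Fintype.card F : ℝ) ^ t - 1))) ^ ⌊ρ * n⌋₊ ≤ ((1 - ρ)⁻¹) ^ n := by
  set Q := (Fintype.card F : ℝ) ^ t
  set r := ⌊ρ * n⌋₊
  have hQi : 0 < 1 / Q := by positivity
  have hρ : 0 < 1 - ρ := by linarith
  have hQ1 : 0 < Q - 1 := by linarith
  set l := ρ / ((1 - ρ) * (Q - 1)) with hl
  have hl0 : 0 ≤ l := by positivity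
  have hl1 : l ≤ 1 := by
    rw [hl, div_le_one (by positivity)]
    have : 1 / Q * Q = 1 := by field_simp
    nlinarith
  have hsum : 1 + (Q - 1) * l = (1 - ρ)⁻¹ := by
    rw [hl]; field_simp; ring
  rw [← hsum, ← aux_sum (F := F) (t := t), ← nsmul_eq_mul, ← Finset.sum_const]
  refine (Finset.sum_le_sum ?_).trans
    (Finset.sum_le_sum_of_subset_of_nonneg (Finset.filter_subset _ _) ?_)
  · intro v hv
    exact pow_le_pow_of_le_one hl0 hl1 (Finset.mem_filter.mp hv).2
  · intro v _ _
    positivity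

lemma aux_main {F : Type*} [Field F] [Fintype F] {t n : ℕ} {ρ : ℝ} (ht : 1 ≤ t) (hn : 1 ≤ n)
    (h0 : 0 ≤ ρ) (h1 : ρ ≤ 1 - 1 / (Fintype.card F : ℝ) ^ t) :
    1 - qEnt (Fintype.card F ^ t) ρ ≤ (kMin F t n ⌊ρ * n⌋₊ : ℝ) / n := by
  classical
  have hQ : 2 ≤ (Fintype.card F : ℝ) ^ t := by
    have h2 : (2:ℝ) ≤ Fintype.card F := by exact_mod_cast Fintype.one_lt_card (α := F)
    exact h2.trans (le_self_pow₀ (by linarith) (by omega))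
  obtain ⟨C, hC, hr⟩ := Nat.sInf_mem (s := { k : ℕ | ∃ C : Submodule F (Fin n → F),
    Module.finrank F C = k ∧ genCovRad (C : Set (Fin n → F)) t ≤ ⌊ρ * n⌋₊ })
    ⟨_, ⊤, rfl, aux_top⟩
  change Module.finrank F C = kMin F t n ⌊ρ * n⌋₊ at hC
  have hc := aux_card C hr
  rw [hC] at hc
  have hb := aux_ball (F := F) (t := t) (n := n) hQ h0 h1
  set k := kMin F t n ⌊ρ * n⌋₊
  have hc' : ((Fintype.card F : ℝ) ^ t) ^ n ≤ ((Fintype.card F : ℝ) ^ t) ^ k *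
      ((Finset.univ.filter
      (fun v : Matrix (Fin t) (Fin n) F => twt v ≤ ⌊ρ * n⌋₊)).card : ℝ) := by
    exact_mod_cast hc
  set B := ((Finset.univ.filter
      (fun v : Matrix (Fin t) (Fin n) F => twt v ≤ ⌊ρ * n⌋₊)).card : ℝ)
  unfold qEnt
  push_cast
  generalize (Fintype.card F : ℝ) ^ t = Q at *
  have hQi : 0 < 1 / Q := by positivity
  have hρ : 0 < 1 - ρ := by linarith
  have hQ1 : 0 < Q - 1 := by linarith
  have hn' : (0:ℝ) < n := by exact_mod_cast hn
  have hL : 0 < Real.log Q := Real.log_pos (by linarith)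
  have hB : 0 < B := by
    by_contra hB
    have : 0 < Q ^ n := by positivity
    have : 0 < Q ^ k := by positivity
    nlinarith
  have hc2 := Real.log_le_log (by positivity) hc'
  rw [Real.log_mul (by positivity) hB.ne', Real.log_pow, Real.log_pow] at hc2
  have key : Real.log B ≤ n * (ρ * Real.log (Q - 1) - ρ * Real.log ρ
      - (1 - ρ) * Real.log (1 - ρ)) := by
    rcases h0.eq_or_lt with h | h
    · subst h
      simp at hb ⊢
      exact Real.log_nonpos hB.le hb
    · set l := ρ / ((1 - ρ) * (Q - 1)) with hl
      have hl0 : 0 < l := by positivity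
      have hl1 : l ≤ 1 := by
        rw [hl, div_le_one (by positivity)]
        have : 1 / Q * Q = 1 := by field_simp
        nlinarith
      have hb2 := Real.log_le_log (by positivity) hb
      rw [Real.log_mul hB.ne' (by positivity), Real.log_pow, Real.log_pow, Real.log_inv] at hb2
      have hle : Real.log l ≤ 0 := Real.log_nonpos hl0.le hl1
      have hfl : (⌊ρ * n⌋₊ : ℝ) ≤ ρ * n := Nat.floor_le (by positivity)
      have hm := mul_le_mul_of_nonpos_right hfl hle
      have hll : Real.log l = Real.log ρ - (Real.log (1 - ρ) + Real.log (Q - 1)) := by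
        rw [hl, Real.log_div h.ne' (by positivity), Real.log_mul hρ.ne' hQ1.ne']
      have : Real.log B ≤ - (n * Real.log (1 - ρ)) - ρ * n * Real.log l := by linarith
      rw [hll] at this
      linarith
  rw [le_div_iff₀ hn']
  simp only [Real.logb]
  have e : (1 - (ρ * (Real.log (Q - 1) / Real.log Q) - ρ * (Real.log ρ / Real.log Q)
      - (1 - ρ) * (Real.log (1 - ρ) / Real.log Q))) * n
      = (n * Real.log Q - n * (ρ * Real.log (Q - 1) - ρ * Real.log ρ
      - (1 - ρ) * Real.log (1 - ρ))) / Real.log Q := by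
    field_simp
  rw [e, div_le_iff₀ hL]
  linarith

theorem stmt6 {F : Type*} [Field F] [Fintype F] {t : ℕ} (ht : 1 ≤ t) {ρ : ℝ}
    (h0 : 0 ≤ ρ) (h1 : ρ ≤ 1 - 1 / (Fintype.card F : ℝ) ^ t) :
    1 - qEnt (Fintype.card F ^ t) ρ ≤ kappa F t ρ := by
  refine Filter.le_liminf_of_le ?_ ?_
  · refine Filter.IsBoundedUnder.isCoboundedUnder_ge ⟨1, ?_⟩
    rw [Filter.eventually_map]
    refine Filter.Eventually.of_forall fun n => ?_
    exact div_le_one_of_le₀ (by exact_mod_cast aux_kle) (by positivity)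
  · filter_upwards [Filter.eventually_ge_atTop 1] with n hn
    exact aux_main ht hn h0 h1
end
end

section
/- Let C be an [n,k] linear code over F_q. Then for all integers t_1, t_2 ≥ 1, the generalized covering radii are subadditive: R_{t_1+t_2}(C) ≤ R_{t_1}(C) + R_{t_2}(C). -/
noncomputable section

theorem genCovRad_spec_aux {F : Type*} [Field F] {n : ℕ} (C : Submodule F (Fin n → F)) (t : ℕ) :
    ∀ v : Matrix (Fin t) (Fin n) F, ∃ c : Matrix (Fin t) (Fin n) F,
      (∀ i, c i ∈ (C : Set (Fin n → F))) ∧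
        v ∈ tBall (genCovRad (C : Set (Fin n → F)) t) c := by
  have hne : {r : ℕ | ∀ v : Matrix (Fin t) (Fin n) F,
    ∃ c : Matrix (Fin t) (Fin n) F,
      (∀ i, c i ∈ (C : Set (Fin n → F))) ∧ v ∈ tBall r c}.Nonempty := by
    refine ⟨n, fun v => ⟨0, fun i => C.zero_mem, ?_⟩⟩
    show Set.ncard _ ≤ n
    refine (Set.ncard_le_ncard (Set.subset_univ _) Set.finite_univ).trans ?_
    simp [Set.ncard_univ]
  exact Nat.sInf_mem hne

theorem stmt9 {F : Type*} [Field F] [Fintype F] {n k : ℕ}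
    (C : Submodule F (Fin n → F)) (hC : Module.finrank F C = k)
    {t₁ t₂ : ℕ} (ht₁ : 1 ≤ t₁) (ht₂ : 1 ≤ t₂) :
    genCovRad (C : Set (Fin n → F)) (t₁ + t₂)
      ≤ genCovRad (C : Set (Fin n → F)) t₁ + genCovRad (C : Set (Fin n → F)) t₂ := by
  apply Nat.sInf_le
  intro v
  obtain ⟨c₁, h₁, b₁⟩ := genCovRad_spec_aux C t₁ (fun i => v (Fin.castAdd t₂ i))
  obtain ⟨c₂, h₂, b₂⟩ := genCovRad_spec_aux C t₂ (fun i => v (Fin.natAdd t₁ i))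
  obtain ⟨c, e₁, e₂⟩ : ∃ c : Matrix (Fin (t₁ + t₂)) (Fin n) F,
      (∀ i, c (Fin.castAdd t₂ i) = c₁ i) ∧ (∀ i, c (Fin.natAdd t₁ i) = c₂ i) :=
    ⟨Fin.append c₁ c₂, fun i => Fin.append_left (α := Fin n → F) c₁ c₂ i,
      fun i => Fin.append_right (α := Fin n → F) c₁ c₂ i⟩
  refine ⟨c, ?_, ?_⟩
  · intro i
    refine Fin.addCases (fun i => ?_) (fun i => ?_) i
    · rw [e₁]; exact h₁ i
    · rw [e₂]; exact h₂ i
  · refine le_trans ?_ (Nat.add_le_add b₁ b₂)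
    refine le_trans (Set.ncard_le_ncard ?_ (Set.toFinite _)) (Set.ncard_union_le _ _)
    rintro j ⟨i, hi⟩
    revert hi
    refine Fin.addCases (fun i hi => ?_) (fun i hi => ?_) i
    · left
      refine ⟨i, ?_⟩
      rw [Matrix.sub_apply, e₁] at hi
      exact hi
    · right
      refine ⟨i, ?_⟩
      rw [Matrix.sub_apply, e₂] at hi
      exact hi
end
end

section
/- Let n > k ≥ 2 be integers, let 1 ≤ r ≤ n−k, and let u_1, u_2 ∈ F_2^{2×k} each have rank 2, such that the 4×k matrix obtained by stacking u_1 on top of u_2 has rank 3. Then for every v ∈ F_2^{2×n}, the number of matrices G ∈ F_2^{k×n} such that both u_1G ∈ B_r^{(2)}(v) and u_2G ∈ B_r^{(2)}(v) is at most the number of matrices G ∈ F_2^{k×n} such that both u_1G ∈ B_r^{(2)}(0) and u_2G ∈ B_r^{(2)}(0). -/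
noncomputable section

open Matrix in
theorem aux_A : ∀ p q : Fin 2 → ZMod 2, p ≠ 0 → q ≠ 0 →
    ∃ A : Matrix (Fin 2) (Fin 2) (ZMod 2), A * A = 1 ∧ p ᵥ* A = q := by
  intro p q hp hq
  have hc : ∀ a b c d : ZMod 2, (![a, b] : Fin 2 → ZMod 2) ≠ 0 → (![c, d] : Fin 2 → ZMod 2) ≠ 0 →
    ∃ e f g h : ZMod 2, e * e + f * g = 1 ∧ e * f + f * h = 0 ∧ g * e + h * g = 0 ∧
      g * f + h * h = 1 ∧ a * e + b * g = c ∧ a * f + b * h = d := by decide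
  have ep : p = ![p 0, p 1] := by ext i; fin_cases i <;> rfl
  have eq : q = ![q 0, q 1] := by ext i; fin_cases i <;> rfl
  obtain ⟨e, f, g, h, h1, h2, h3, h4, h5, h6⟩ := hc (p 0) (p 1) (q 0) (q 1) (ep ▸ hp) (eq ▸ hq)
  refine ⟨!![e, f; g, h], ?_, ?_⟩
  · ext i j
    fin_cases i <;> fin_cases j <;> simp [Matrix.mul_apply, Fin.sum_univ_two, *]
  · ext i
    fin_cases i <;> simp [Matrix.vecMul, dotProduct, Fin.sum_univ_two, h5, h6]

theorem twt_mul_le {n : ℕ} (A : Matrix (Fin 2) (Fin 2) (ZMod 2))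
    (b : Matrix (Fin 2) (Fin n) (ZMod 2)) : twt (A * b) ≤ twt b := by
  unfold twt
  apply Set.ncard_le_ncard _ (Set.toFinite _)
  rintro j ⟨i, hi⟩
  by_contra hcon
  simp only [Set.mem_setOf_eq, not_exists, not_not] at hcon
  apply hi
  simp [Matrix.mul_apply, hcon]

open Matrix Classical in
theorem count_eq {n : ℕ} (r : ℕ) (p q : Fin 2 → ZMod 2) (hp : p ≠ 0) (hq : q ≠ 0)
    (x : Fin n → ZMod 2) :
    (Finset.univ.filter fun a : Matrix (Fin 2) (Fin n) (ZMod 2) => twt a ≤ r ∧ p ᵥ* a = x).card =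
    (Finset.univ.filter fun a : Matrix (Fin 2) (Fin n) (ZMod 2) => twt a ≤ r ∧ q ᵥ* a = x).card := by
  obtain ⟨A, hA, hpq⟩ := aux_A p q hp hq
  have hqp : q ᵥ* A = p := by rw [← hpq, vecMul_vecMul, hA, vecMul_one]
  refine Finset.card_bij' (fun a _ => A * a) (fun a _ => A * a) ?_ ?_ ?_ ?_
  · intro a ha
    simp only [Finset.mem_filter, Finset.mem_univ, true_and] at ha ⊢
    exact ⟨(twt_mul_le A a).trans ha.1, by rw [← vecMul_vecMul, hqp, ha.2]⟩
  · intro a ha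
    simp only [Finset.mem_filter, Finset.mem_univ, true_and] at ha ⊢
    exact ⟨(twt_mul_le A a).trans ha.1, by rw [← vecMul_vecMul, hpq, ha.2]⟩
  · intro a _
    simp [← Matrix.mul_assoc, hA]
  · intro a _
    simp [← Matrix.mul_assoc, hA]

open Matrix Classical in
theorem pair_count {n : ℕ} (r : ℕ) (p q : Fin 2 → ZMod 2) (hp : p ≠ 0) (hq : q ≠ 0)
    (v : Matrix (Fin 2) (Fin n) (ZMod 2)) :
    (Finset.univ.filter fun z : Matrix (Fin 2) (Fin n) (ZMod 2) × Matrix (Fin 2) (Fin n) (ZMod 2) =>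
      p ᵥ* z.1 + q ᵥ* z.2 = 0 ∧ twt (z.1 - v) ≤ r ∧ twt (z.2 - v) ≤ r).card =
    ∑ x : Fin n → ZMod 2,
      (Finset.univ.filter fun a : Matrix (Fin 2) (Fin n) (ZMod 2) => twt a ≤ r ∧ p ᵥ* a = x).card *
      (Finset.univ.filter fun a : Matrix (Fin 2) (Fin n) (ZMod 2) =>
        twt a ≤ r ∧ p ᵥ* a = -(p ᵥ* v + q ᵥ* v) - x).card := by
  rw [Finset.card_eq_sum_card_fiberwise (f := fun z => p ᵥ* (z.1 - v)) (t := Finset.univ)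
    (fun _ _ => by simp)]
  refine Finset.sum_congr rfl fun x _ => ?_
  rw [count_eq r p q hp hq (-(p ᵥ* v + q ᵥ* v) - x), ← Finset.card_product]
  refine Finset.card_bij' (fun z _ => (z.1 - v, z.2 - v)) (fun z _ => (z.1 + v, z.2 + v)) ?_ ?_ ?_ ?_
  · rintro ⟨a, b⟩ h
    simp only [Finset.mem_filter, Finset.mem_univ, true_and, Finset.mem_product] at h ⊢
    obtain ⟨⟨h0, h1, h2⟩, h3⟩ := h
    refine ⟨⟨h1, h3⟩, h2, ?_⟩
    rw [← h3, Matrix.vecMul_sub, Matrix.vecMul_sub]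
    rw [← sub_eq_zero, ← h0]; abel
  · rintro ⟨a, b⟩ h
    simp only [Finset.mem_filter, Finset.mem_univ, true_and, Finset.mem_product] at h ⊢
    obtain ⟨⟨h0, h1⟩, h2, h3⟩ := h
    simp only [add_sub_cancel_right]
    refine ⟨⟨?_, h0, h2⟩, h1⟩
    rw [Matrix.vecMul_add, Matrix.vecMul_add, h1, h3]; abel
  · intro z _; simp
  · intro z _; simp

open Matrix Classical in
theorem pair_count_le {n : ℕ} (r : ℕ) (p q : Fin 2 → ZMod 2) (hp : p ≠ 0) (hq : q ≠ 0)
    (v : Matrix (Fin 2) (Fin n) (ZMod 2)) :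
    (Finset.univ.filter fun z : Matrix (Fin 2) (Fin n) (ZMod 2) × Matrix (Fin 2) (Fin n) (ZMod 2) =>
      p ᵥ* z.1 + q ᵥ* z.2 = 0 ∧ twt (z.1 - v) ≤ r ∧ twt (z.2 - v) ≤ r).card ≤
    (Finset.univ.filter fun z : Matrix (Fin 2) (Fin n) (ZMod 2) × Matrix (Fin 2) (Fin n) (ZMod 2) =>
      p ᵥ* z.1 + q ᵥ* z.2 = 0 ∧ twt (z.1 - 0) ≤ r ∧ twt (z.2 - 0) ≤ r).card := by
  rw [pair_count r p q hp hq v, pair_count r p q hp hq 0]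
  set f : (Fin n → ZMod 2) → ℕ := fun x =>
    (Finset.univ.filter fun a : Matrix (Fin 2) (Fin n) (ZMod 2) => twt a ≤ r ∧ p ᵥ* a = x).card
    with hf
  set s := -(p ᵥ* v + q ᵥ* v)
  change ∑ x, f x * f (s - x) ≤ ∑ x, f x * f (-(p ᵥ* 0 + q ᵥ* 0) - x)
  have hneg : ∀ x : Fin n → ZMod 2, -x = x := fun x => by
    ext i; exact ZMod.neg_eq_self_mod_two _
  have e0 : ∀ x, -(p ᵥ* (0 : Matrix (Fin 2) (Fin n) (ZMod 2)) + q ᵥ* 0) - x = x := by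
    intro x; simp [hneg]
  simp only [e0]
  have h1 : ∑ x, f (s - x) * f (s - x) = ∑ x, f x * f x :=
    Equiv.sum_comp (Equiv.subLeft s) (fun x => f x * f x)
  have h2 : ∑ x, 2 * (f x * f (s - x)) ≤ ∑ x, (f x * f x + f (s - x) * f (s - x)) := by
    refine Finset.sum_le_sum fun x _ => ?_
    have := two_mul_le_add_sq (f x) (f (s - x))
    nlinarith
  rw [Finset.sum_add_distrib, h1, ← Finset.mul_sum] at h2
  omega

open Matrix in
theorem range_char {k : ℕ} (u₁ u₂ : Matrix (Fin 2) (Fin k) (ZMod 2)) (h1 : u₁.rank = 2)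
    (h2 : u₂.rank = 2) (h3 : (Matrix.fromRows u₁ u₂).rank = 3) :
    ∃ p q : Fin 2 → ZMod 2, p ≠ 0 ∧ q ≠ 0 ∧ ∀ a b : Fin 2 → ZMod 2,
      (∃ g, u₁ *ᵥ g = a ∧ u₂ *ᵥ g = b) ↔ p ⬝ᵥ a + q ⬝ᵥ b = 0 := by
  have inj : ∀ u : Matrix (Fin 2) (Fin k) (ZMod 2), u.rank = 2 → ∀ p, p ᵥ* u = 0 → p = 0 := by
    intro u hu p hp
    have hli : LinearIndependent (ZMod 2) u.row := by
      rw [linearIndependent_iff_card_eq_finrank_span, Set.finrank, ← rank_eq_finrank_span_row, hu]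
      simp
    exact (Matrix.vecMul_injective_iff.2 hli) (by simpa using hp)
  set M := Matrix.fromRows u₁ u₂ with hM
  have hnot : ¬ Function.Injective M.vecMul := by
    rw [Matrix.vecMul_injective_iff]
    intro hli
    have := hli.rank_matrix
    rw [h3] at this
    simp at this
  obtain ⟨w, hw, hw0⟩ : ∃ w, w ᵥ* M = 0 ∧ w ≠ 0 := by
    by_contra hcon
    push Not at hcon
    apply hnot
    intro x y hxy
    rw [← sub_eq_zero]
    apply hcon
    rw [sub_vecMul, sub_eq_zero]; exact hxy
  have hsplit : (w ∘ Sum.inl) ᵥ* u₁ + (w ∘ Sum.inr) ᵥ* u₂ = 0 := by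
    rw [← hw, hM, vecMul_fromRows]
  refine ⟨w ∘ Sum.inl, w ∘ Sum.inr, ?_, ?_, ?_⟩
  · intro h
    rw [h, zero_vecMul, zero_add] at hsplit
    have h' := inj u₂ h2 _ hsplit
    apply hw0
    ext (i | i)
    · exact congrFun h i
    · exact congrFun h' i
  · intro h
    rw [h, zero_vecMul, add_zero] at hsplit
    have h' := inj u₁ h1 _ hsplit
    apply hw0
    ext (i | i)
    · exact congrFun h' i
    · exact congrFun h i
  · let φ : Module.Dual (ZMod 2) (Fin 2 ⊕ Fin 2 → ZMod 2) := dotProductBilin (ZMod 2) (ZMod 2) w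
    have hφ : ∀ x, φ x = w ⬝ᵥ x := fun x => rfl
    have hφ0 : φ ≠ 0 := by
      intro h
      apply hw0
      ext i
      have := hφ (Pi.single i 1)
      rw [h] at this
      simpa using this.symm
    have hle : LinearMap.range M.mulVecLin ≤ LinearMap.ker φ := by
      rintro _ ⟨g, rfl⟩
      rw [LinearMap.mem_ker, hφ, mulVecLin_apply, dotProduct_mulVec, hw, zero_dotProduct]
    have hfr := Module.Dual.finrank_ker_add_one_of_ne_zero hφ0
    have heq : LinearMap.range M.mulVecLin = LinearMap.ker φ := by
      apply Submodule.eq_of_le_of_finrank_eq hle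
      change M.rank = _
      rw [h3]
      simp at hfr
      omega
    intro a b
    have hk : Sum.elim a b ∈ LinearMap.ker φ ↔ (w ∘ Sum.inl) ⬝ᵥ a + (w ∘ Sum.inr) ⬝ᵥ b = 0 := by
      rw [LinearMap.mem_ker, hφ]
      simp [dotProduct]
    rw [← hk, ← heq, LinearMap.mem_range]
    refine exists_congr fun g => ?_
    rw [mulVecLin_apply, hM, fromRows_mulVec]
    constructor
    · rintro ⟨rfl, rfl⟩; rfl
    · intro h
      exact ⟨funext fun i => congrFun h (Sum.inl i), funext fun i => congrFun h (Sum.inr i)⟩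

open Matrix Classical in
theorem lift_count {n k : ℕ} (r : ℕ) (u₁ u₂ : Matrix (Fin 2) (Fin k) (ZMod 2))
    (p q : Fin 2 → ZMod 2) (hpq : ∀ a b : Fin 2 → ZMod 2,
      (∃ g, u₁ *ᵥ g = a ∧ u₂ *ᵥ g = b) ↔ p ⬝ᵥ a + q ⬝ᵥ b = 0)
    (v : Matrix (Fin 2) (Fin n) (ZMod 2)) :
    Set.ncard {G : Matrix (Fin k) (Fin n) (ZMod 2) | u₁ * G ∈ tBall r v ∧ u₂ * G ∈ tBall r v} =
    (Finset.univ.filter fun z : Matrix (Fin 2) (Fin n) (ZMod 2) × Matrix (Fin 2) (Fin n) (ZMod 2) =>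
      p ᵥ* z.1 + q ᵥ* z.2 = 0 ∧ twt (z.1 - v) ≤ r ∧ twt (z.2 - v) ≤ r).card *
    (Finset.univ.filter fun G : Matrix (Fin k) (Fin n) (ZMod 2) => u₁ * G = 0 ∧ u₂ * G = 0).card := by
  have hrange : ∀ X Y : Matrix (Fin 2) (Fin n) (ZMod 2), p ᵥ* X + q ᵥ* Y = 0 ↔
      ∃ G : Matrix (Fin k) (Fin n) (ZMod 2), u₁ * G = X ∧ u₂ * G = Y := by
    intro X Y
    constructor
    · intro h
      have : ∀ j, ∃ g, u₁ *ᵥ g = X.col j ∧ u₂ *ᵥ g = Y.col j := fun j =>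
        (hpq _ _).2 (congrFun h j)
      choose g hg using this
      refine ⟨Matrix.of fun i j => g j i, ?_, ?_⟩
      · ext i j; exact congrFun (hg j).1 i
      · ext i j; exact congrFun (hg j).2 i
    · rintro ⟨G, rfl, rfl⟩
      ext j
      exact (hpq _ _).1 ⟨G.col j, rfl, rfl⟩
  rw [Set.ncard_eq_toFinset_card', Finset.card_eq_sum_card_fiberwise
    (f := fun G => (u₁ * G, u₂ * G)) (t := Finset.univ.filter fun z : Matrix (Fin 2) (Fin n) (ZMod 2) × Matrix (Fin 2) (Fin n) (ZMod 2) =>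
      p ᵥ* z.1 + q ᵥ* z.2 = 0 ∧ twt (z.1 - v) ≤ r ∧ twt (z.2 - v) ≤ r)]
  · rw [Finset.sum_const_nat]
    rintro ⟨X, Y⟩ hz
    simp only [Finset.mem_filter, Finset.mem_univ, true_and] at hz
    obtain ⟨hz, hX, hY⟩ := hz
    obtain ⟨G₀, rfl, rfl⟩ := (hrange X Y).1 hz
    refine Finset.card_bij' (fun G _ => G - G₀) (fun G _ => G + G₀) ?_ ?_ ?_ ?_
    · intro G hG
      simp only [Finset.mem_filter, Finset.mem_univ, true_and, Prod.mk.injEq] at hG ⊢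
      simp [Matrix.mul_sub, hG.2.1, hG.2.2]
    · intro G hG
      simp only [Finset.mem_filter, Finset.mem_univ, true_and] at hG
      have e1 : u₁ * (G + G₀) = u₁ * G₀ := by rw [Matrix.mul_add, hG.1, zero_add]
      have e2 : u₂ * (G + G₀) = u₂ * G₀ := by rw [Matrix.mul_add, hG.2, zero_add]
      rw [Finset.mem_filter, Set.mem_toFinset]
      refine ⟨⟨?_, ?_⟩, by rw [e1, e2]⟩
      · rw [e1]; exact hX
      · rw [e2]; exact hY
    · intro G _; simp
    · intro G _; simp
  · intro G hG
    simp only [Set.coe_toFinset, Set.mem_setOf_eq, tBall] at hG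
    simp only [Finset.coe_filter, Finset.mem_univ, true_and, Set.mem_setOf_eq]
    exact ⟨(hrange _ _).2 ⟨G, rfl, rfl⟩, hG⟩

theorem stmt12 {n k : ℕ} (hk2 : 2 ≤ k) (hkn : k < n) {r : ℕ} (hr1 : 1 ≤ r)
    (hr2 : r ≤ n - k)
    (u₁ u₂ : Matrix (Fin 2) (Fin k) (ZMod 2)) (h1 : u₁.rank = 2) (h2 : u₂.rank = 2)
    (h3 : (Matrix.fromRows u₁ u₂).rank = 3) (v : Matrix (Fin 2) (Fin n) (ZMod 2)) :
    Set.ncard {G : Matrix (Fin k) (Fin n) (ZMod 2) |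
        u₁ * G ∈ tBall r v ∧ u₂ * G ∈ tBall r v}
      ≤ Set.ncard {G : Matrix (Fin k) (Fin n) (ZMod 2) |
          u₁ * G ∈ tBall r (0 : Matrix (Fin 2) (Fin n) (ZMod 2)) ∧
          u₂ * G ∈ tBall r (0 : Matrix (Fin 2) (Fin n) (ZMod 2))} := by
  obtain ⟨p, q, hp, hq, hpq⟩ := range_char u₁ u₂ h1 h2 h3
  rw [lift_count r u₁ u₂ p q hpq v, lift_count r u₁ u₂ p q hpq 0]
  exact Nat.mul_le_mul_right _ (pair_count_le r p q hp hq v)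
end
end

section
/- Let 3 ≤ k ≤ n be integers, let 0 ≤ r ≤ n, and let v ∈ F_2^{2×n}. Define N_v to be the number of pairs (u, G) with u ∈ F_2^{2×k} of rank 2 and G ∈ F_2^{k×n} such that v ∈ B_r^{(2)}(uG). Then N_v = (2^k − 1)(2^k − 2)·2^{(k−2)n}·V_{r,n,2}^{(2)}, and consequently V_{r,n,2}^{(2)}·2^{2k−1−2n} < N_v/2^{kn} < V_{r,n,2}^{(2)}·2^{2k−2n}. -/
noncomputable section

open Classical in
theorem aux_fib {A B : Type*} [AddCommGroup A] [AddCommGroup B] [Fintype A] [Fintype B]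
    (f : A →+ B) (hf : Function.Surjective f) :
    ∃ c : ℕ, ∀ S : Finset B, (Finset.univ.filter (fun a => f a ∈ S)).card = S.card * c := by
  refine ⟨(Finset.univ.filter (fun a => f a = 0)).card, fun S => ?_⟩
  rw [Finset.card_eq_sum_card_fiberwise (f := f) (t := S) (by intro a; simp)]
  rw [← smul_eq_mul]
  apply Finset.sum_eq_card_nsmul
  intro b hb
  obtain ⟨a0, rfl⟩ := hf b
  symm
  apply Finset.card_bij (fun a _ => a + a0)
  · intro a ha
    simp at ha ⊢
    simp [ha, hb]
  · intro a _ a' _ h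
    simpa using h
  · intro a ha
    simp at ha
    exact ⟨a - a0, by simp [ha.2], by simp⟩

theorem aux_rank {k : ℕ} :
    Nat.card {u : Matrix (Fin 2) (Fin k) (ZMod 2) // u.rank = 2} = (2 ^ k - 1) * (2 ^ k - 2) := by
  have h1 : ∀ u : Matrix (Fin 2) (Fin k) (ZMod 2), u.rank = 2 ↔ LinearIndependent (ZMod 2) u.row := by
    intro u
    rw [linearIndependent_iff_card_eq_finrank_span, Matrix.rank_eq_finrank_span_row]
    simp [Set.finrank, eq_comm]
  by_cases hk : 2 ≤ k
  · have := card_linearIndependent (K := ZMod 2) (V := Fin k → ZMod 2) (k := 2) (by simpa using hk)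
    simp [Fin.prod_univ_two] at this
    rw [← this]
    exact Nat.card_congr (Equiv.subtypeEquivRight h1)
  · have : ∀ u : Matrix (Fin 2) (Fin k) (ZMod 2), u.rank ≠ 2 := by
      intro u h
      have := u.rank_le_width
      omega
    have : IsEmpty {u : Matrix (Fin 2) (Fin k) (ZMod 2) // u.rank = 2} := ⟨fun u => this u.1 u.2⟩
    have : k = 0 ∨ k = 1 := by omega
    rcases this with rfl | rfl <;> simp

theorem aux_surj {k n : ℕ} (u : Matrix (Fin 2) (Fin k) (ZMod 2)) (hu : u.rank = 2) :
    Function.Surjective (fun G : Matrix (Fin k) (Fin n) (ZMod 2) => u * G) := by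
  have hs : Function.Surjective u.mulVecLin := by
    rw [← LinearMap.range_eq_top]
    apply Submodule.eq_top_of_finrank_eq
    rw [← Matrix.rank, hu]; simp
  intro w
  choose g hg using fun j => hs (w.col j)
  refine ⟨Matrix.of (fun i j => g j i), ?_⟩
  ext i j
  have := congrFun (hg j) i
  simpa [Matrix.mul_apply, Matrix.mulVec, dotProduct] using this

theorem aux_count {k n : ℕ} (hk : 2 ≤ k) (r : ℕ) (v : Matrix (Fin 2) (Fin n) (ZMod 2))
    (u : Matrix (Fin 2) (Fin k) (ZMod 2)) (hu : u.rank = 2) :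
    Nat.card {G : Matrix (Fin k) (Fin n) (ZMod 2) // v ∈ tBall r (u * G)} =
      2 ^ ((k - 2) * n) * (tBall r (0 : Matrix (Fin 2) (Fin n) (ZMod 2))).ncard := by
  classical
  let f : Matrix (Fin k) (Fin n) (ZMod 2) →+ Matrix (Fin 2) (Fin n) (ZMod 2) :=
    { toFun := fun G => u * G, map_zero' := by simp, map_add' := fun a b => Matrix.mul_add u a b }
  obtain ⟨c, hc⟩ := aux_fib f (aux_surj u hu)
  have hcc : c = 2 ^ ((k - 2) * n) := by
    have h := hc Finset.univ
    have hA : Fintype.card (Matrix (Fin k) (Fin n) (ZMod 2)) = 2 ^ (k * n) := by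
      rw [← Nat.card_eq_fintype_card, Matrix, Nat.card_fun, Nat.card_fun]
      simp [← pow_mul, mul_comm]
    have hB : Fintype.card (Matrix (Fin 2) (Fin n) (ZMod 2)) = 2 ^ (2 * n) := by
      rw [← Nat.card_eq_fintype_card, Matrix, Nat.card_fun, Nat.card_fun]
      simp [← pow_mul, mul_comm]
    simp only [Finset.mem_univ, Finset.filter_true, Finset.card_univ, hA, hB] at h
    have e : 2 ^ (k * n) = (2 ^ (2 * n)) * 2 ^ ((k - 2) * n) := by
      rw [← pow_add, ← add_mul]; congr 2; omega
    rw [e] at h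
    exact (Nat.eq_of_mul_eq_mul_left (by positivity) h).symm
  have h := hc (Finset.univ.filter (fun w => v ∈ tBall r w))
  have hb : (Finset.univ.filter (fun w => v ∈ tBall r w)).card =
      (tBall r (0 : Matrix (Fin 2) (Fin n) (ZMod 2))).ncard := by
    rw [← Set.ncard_coe_finset]
    apply Set.ncard_congr (fun w _ => v - w)
    · intro w hw
      have hw := (Finset.mem_filter.1 (Finset.mem_coe.1 hw)).2
      simpa [tBall] using hw
    · intro a b _ _ h
      simpa using h
    · intro b hb
      exact ⟨v - b, Finset.mem_coe.2 (Finset.mem_filter.2 ⟨Finset.mem_univ _, by simpa [tBall] using hb⟩), by simp⟩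
  rw [hb, hcc] at h
  rw [mul_comm, ← h, Nat.card_eq_fintype_card, Fintype.card_subtype]
  congr 1
  ext G
  simp [f]

theorem aux_N {k n : ℕ} (hk : 2 ≤ k) (r : ℕ) (v : Matrix (Fin 2) (Fin n) (ZMod 2)) :
    Set.ncard {p :
        Matrix (Fin 2) (Fin k) (ZMod 2) × Matrix (Fin k) (Fin n) (ZMod 2) |
      p.1.rank = 2 ∧ v ∈ tBall r (p.1 * p.2)} =
    (2 ^ k - 1) * (2 ^ k - 2) * 2 ^ ((k - 2) * n) *
      (tBall r (0 : Matrix (Fin 2) (Fin n) (ZMod 2))).ncard := by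
  classical
  let e : {p : Matrix (Fin 2) (Fin k) (ZMod 2) × Matrix (Fin k) (Fin n) (ZMod 2) |
      p.1.rank = 2 ∧ v ∈ tBall r (p.1 * p.2)} ≃
      (Σ u : {u : Matrix (Fin 2) (Fin k) (ZMod 2) // u.rank = 2},
        {G : Matrix (Fin k) (Fin n) (ZMod 2) // v ∈ tBall r (u.1 * G)}) :=
    { toFun := fun p => ⟨⟨p.1.1, p.2.1⟩, ⟨p.1.2, p.2.2⟩⟩
      invFun := fun q => ⟨(q.1.1, q.2.1), q.1.2, q.2.2⟩
      left_inv := fun _ => rfl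
      right_inv := fun _ => rfl }
  rw [← Nat.card_coe_set_eq, Nat.card_congr e, Nat.card_sigma,
    Finset.sum_congr rfl (fun u _ => aux_count hk r v u.1 u.2)]
  rw [Finset.sum_const, smul_eq_mul, Finset.card_univ, ← Nat.card_eq_fintype_card, aux_rank]
  ring

theorem stmt13 {n k : ℕ} (hk : 3 ≤ k) (hkn : k ≤ n) {r : ℕ} (hr : r ≤ n)
    (v : Matrix (Fin 2) (Fin n) (ZMod 2)) (N V : ℕ)
    (hN : N = Set.ncard {p :
        Matrix (Fin 2) (Fin k) (ZMod 2) × Matrix (Fin k) (Fin n) (ZMod 2) |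
      p.1.rank = 2 ∧ v ∈ tBall r (p.1 * p.2)})
    (hV : V = (tBall r (0 : Matrix (Fin 2) (Fin n) (ZMod 2))).ncard) :
    N = (2 ^ k - 1) * (2 ^ k - 2) * 2 ^ ((k - 2) * n) * V ∧
      (V : ℝ) * (2 : ℝ) ^ (2 * (k : ℤ) - 1 - 2 * n) < (N : ℝ) / 2 ^ (k * n) ∧
      (N : ℝ) / 2 ^ (k * n) < (V : ℝ) * (2 : ℝ) ^ (2 * (k : ℤ) - 2 * n) := by
  have hNV : N = (2 ^ k - 1) * (2 ^ k - 2) * 2 ^ ((k - 2) * n) * V := by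
    rw [hN, hV]; exact aux_N (by omega) r v
  have hVpos : 0 < V := by
    rw [hV, Set.ncard_pos]
    exact ⟨0, by simp [tBall, twt]⟩
  have hVr : (0 : ℝ) < V := by exact_mod_cast hVpos
  have h8 : 8 ≤ 2 ^ k := by
    calc 8 = 2 ^ 3 := by norm_num
      _ ≤ 2 ^ k := Nat.pow_le_pow_right (by norm_num) hk
  have h8r : (8 : ℝ) ≤ 2 ^ k := by exact_mod_cast h8
  have hNr : (N : ℝ) = ((2 ^ k - 1) * (2 ^ k - 2)) * 2 ^ ((k - 2) * n) * V := by
    rw [hNV]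
    push_cast [Nat.cast_sub (show 1 ≤ 2 ^ k by omega), Nat.cast_sub (show 2 ≤ 2 ^ k by omega)]
    ring
  have e : (2 : ℝ) ^ (k * n) = (2 ^ n) ^ 2 * 2 ^ ((k - 2) * n) := by
    rw [← pow_mul, ← pow_add, mul_comm n 2, ← add_mul]; congr 2; omega
  have hq : (N : ℝ) / 2 ^ (k * n) = V * (((2 ^ k - 1) * (2 ^ k - 2)) / (2 ^ n) ^ 2) := by
    rw [hNr, e]; field_simp
  have z2 : (2 : ℝ) ^ (2 * (k : ℤ) - 2 * n) = (2 ^ k) ^ 2 / (2 ^ n) ^ 2 := by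
    rw [zpow_sub₀ (by norm_num), mul_comm, zpow_mul, mul_comm, zpow_mul]
    norm_cast
  have z1 : (2 : ℝ) ^ (2 * (k : ℤ) - 1 - 2 * n) = ((2 ^ k) ^ 2 / 2) / (2 ^ n) ^ 2 := by
    rw [show 2 * (k : ℤ) - 1 - 2 * n = (2 * (k : ℤ) - 2 * n) - 1 by ring,
      zpow_sub_one₀ (by norm_num), z2]
    ring
  refine ⟨hNV, ?_, ?_⟩
  · rw [hq, z1]
    gcongr
    nlinarith
  · rw [hq, z2]
    gcongr
    nlinarith
end
end

section
/- Define f_1(ρ) = sup{ H_2(α) + α·H_2(β/α) + 2(α−β) + (1−α+β)·H_2(γ/(1−α+β)) : 0 ≤ α ≤ ρ, 0 ≤ β ≤ α, 0 ≤ γ ≤ ρ−α+β } and f_2(ρ) = sup{ H_2(α) + 2(1−α)·H_2(β/(1−α)) + 2α : 0 ≤ α ≤ ρ, 0 ≤ β ≤ ρ−α }, where terms of the form x·H_2(y/x) are interpreted as 0 when x = 0, and set f(ρ) = max(f_1(ρ), f_2(ρ)). Then the minimal asymptotic rate of binary codes with normalized second generalized covering radius at most ρ satisfies: κ_2(ρ,2)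 ≤ 1 − (4·H_4(ρ) − f(ρ)) for 0 ≤ ρ < 3/4, and κ_2(ρ,2) = 0 for 3/4 ≤ ρ ≤ 1. -/
noncomputable section

/-- The function `f₁` from the variance bound: a constrained supremum of an entropy
expression. Terms of the form `x * H₂(y / x)` are interpreted as `0` when `x = 0`
(which holds automatically since `0 * a = 0` in `ℝ`). -/
noncomputable def f1 (ρ : ℝ) : ℝ :=
  sSup { y : ℝ | ∃ α β γ : ℝ, 0 ≤ α ∧ α ≤ ρ ∧ 0 ≤ β ∧ β ≤ α ∧ 0 ≤ γ ∧ γ ≤ ρ - α + β ∧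
    y = qEnt 2 α + α * qEnt 2 (β / α) + 2 * (α - β)
        + (1 - α + β) * qEnt 2 (γ / (1 - α + β)) }

/-- The function `f₂` from the variance bound. -/
noncomputable def f2 (ρ : ℝ) : ℝ :=
  sSup { y : ℝ | ∃ α β : ℝ, 0 ≤ α ∧ α ≤ ρ ∧ 0 ≤ β ∧ β ≤ ρ - α ∧
    y = qEnt 2 α + 2 * (1 - α) * qEnt 2 (β / (1 - α)) + 2 * α }

section Helpers

open Finset

abbrev VV (n : ℕ) := Fin n → ZMod 2

def Wt {n : ℕ} (v : VV n × VV n) : ℕ := (univ.filter fun j => v.1 j ≠ 0 ∨ v.2 j ≠ 0).card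

def BB (n r : ℕ) : Finset (VV n × VV n) := univ.filter fun v => Wt v ≤ r

def TT (n r : ℕ) (a : VV n × VV n) : ℕ := ((BB n r).filter fun b => b + a ∈ BB n r).card

def PP (n r : ℕ) : ℕ := ∑ w : VV n, TT n r (0, w)

lemma Wt_swap {n : ℕ} (x y : VV n) : Wt (y, x) = Wt (x, y) := by
  unfold Wt; congr 1; ext j; simp [or_comm]

lemma Wt_add {n : ℕ} (x y : VV n) : Wt (x + y, y) = Wt (x, y) := by
  unfold Wt; congr 1; ext j
  simp only [mem_filter, mem_univ, true_and, Pi.add_apply]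
  generalize x j = a; generalize y j = b; revert a b; decide

lemma TT_swap {n : ℕ} (r : ℕ) (w : VV n) : TT n r (w, 0) = TT n r (0, w) := by
  unfold TT
  refine card_bij' (fun b _ => b.swap) (fun b _ => b.swap) ?_ ?_ ?_ ?_
  · rintro ⟨x, y⟩ h
    simpa [BB, Wt_swap] using h
  · rintro ⟨x, y⟩ h
    simpa [BB, Wt_swap] using h
  · simp
  · simp

lemma TT_diag {n : ℕ} (r : ℕ) (w : VV n) : TT n r (w, w) = TT n r (0, w) := by
  have hz : ∀ w : VV n, w + w = 0 := fun w => by ext j; exact CharTwo.add_self_eq_zero _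
  unfold TT
  refine card_bij' (fun b _ => (b.1 + b.2, b.2)) (fun b _ => (b.1 + b.2, b.2)) ?_ ?_ ?_ ?_
  · rintro ⟨x, y⟩ h
    simp only [BB, mem_filter, mem_univ, true_and, Prod.mk_add_mk] at h ⊢
    rw [← Wt_add (x + w)] at h
    rw [Wt_add]
    have : x + w + (y + w) = x + y + 0 := by
      rw [← hz w]; abel
    rwa [this] at h
  · rintro ⟨x, y⟩ h
    simp only [BB, mem_filter, mem_univ, true_and, Prod.mk_add_mk] at h ⊢
    rw [← Wt_add (x + y + w)] 
    rw [Wt_add]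
    have : x + y + w + (y + w) = x + 0 + (y + y) + (w + w) := by abel
    rw [this, hz, hz]
    simpa using h
  · rintro ⟨x, y⟩ h
    simp [add_assoc, hz]
  · rintro ⟨x, y⟩ h
    simp [add_assoc, hz]

/-- summation over a surjective hom -/
lemma sum_hom {A H : Type*} [AddCommGroup A] [AddCommGroup H] [Fintype A] [Fintype H]
    (f : A →+ H) (hf : Function.Surjective f) (φ : H → ℕ) :
    Fintype.card H * ∑ g, φ (f g) = Fintype.card A * ∑ h, φ h := by
  have h1 : ∀ h : H, ∑ g, φ (f g + h) = ∑ g, φ (f g) := by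
    intro h
    obtain ⟨g0, rfl⟩ := hf h
    simp_rw [← map_add]
    exact Equiv.sum_comp (Equiv.addRight g0) (fun g => φ (f g))
  have h2 : ∀ g : A, ∑ h, φ (f g + h) = ∑ h, φ h := by
    intro g
    exact Equiv.sum_comp (Equiv.addLeft (f g)) φ
  calc Fintype.card H * ∑ g, φ (f g) = ∑ h : H, ∑ g, φ (f g + h) := by
        simp [h1]
    _ = ∑ g, ∑ h : H, φ (f g + h) := sum_comm
    _ = _ := by simp [h2]

lemma sum_TT (n r : ℕ) : ∑ a, TT n r a = (BB n r).card ^ 2 := by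
  unfold TT
  simp_rw [card_filter]
  rw [sum_comm]
  have : ∀ b : VV n × VV n, ∑ a : VV n × VV n, (if b + a ∈ BB n r then 1 else 0) = (BB n r).card := by
    intro b
    refine (Equiv.sum_comp (Equiv.addLeft b) (fun a => if a ∈ BB n r then 1 else 0)).trans ?_
    simp
  simp [this, sq]

/-- squaring step -/
lemma exists_shift {A : Type*} [AddCommGroup A] [Fintype A] [DecidableEq A] (U : Finset A) :
    ∃ a : A, (U.filter fun v => v + a ∈ U).card * Fintype.card A ≤ U.card ^ 2 := by
  have hs : ∑ a : A, (U.filter fun v => v + a ∈ U).card = U.card ^ 2 := by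
    simp_rw [card_filter]
    rw [sum_comm]
    have : ∀ b : A, ∑ a : A, (if b + a ∈ U then 1 else 0) = U.card := by
      intro b
      refine (Equiv.sum_comp (Equiv.addLeft b) (fun a => if a ∈ U then 1 else 0)).trans ?_
      simp
    simp [this, sq]
  by_contra! h
  have := sum_lt_sum_of_nonempty (s := (univ : Finset A)) ⟨0, mem_univ _⟩ (fun a _ => h a)
  rw [← sum_mul, hs] at this
  simp at this
  rw [mul_comm] at this
  exact lt_irrefl _ this

open Classical in
noncomputable def covS (n r : ℕ) (C : Submodule (ZMod 2) (VV n)) : Finset (VV n × VV n) :=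
  univ.filter fun v => ∃ c : VV n × VV n, c.1 ∈ C ∧ c.2 ∈ C ∧ v + c ∈ BB n r

lemma unc_step (n r : ℕ) (C : Submodule (ZMod 2) (VV n)) :
    ∃ C' : Submodule (ZMod 2) (VV n), Module.finrank (ZMod 2) C' ≤ Module.finrank (ZMod 2) C + 2 ∧
      (covS n r C')ᶜ.card * Fintype.card (VV n × VV n) ≤ (covS n r C)ᶜ.card ^ 2 := by
  obtain ⟨a, ha⟩ := exists_shift (covS n r C)ᶜ
  refine ⟨C ⊔ Submodule.span (ZMod 2) ({a.1, a.2} : Finset (VV n)), ?_, ?_⟩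
  · refine (Submodule.finrank_add_le_finrank_add_finrank _ _).trans ?_
    gcongr
    refine (finrank_span_finset_le_card _).trans ?_
    exact card_le_two
  · refine le_trans ?_ ha
    gcongr
    intro v hv
    rw [mem_filter]
    simp only [covS, mem_compl, mem_filter, mem_univ, true_and, not_exists, not_and] at hv ⊢
    have h1 : a.1 ∈ Submodule.span (ZMod 2) ((({a.1, a.2} : Finset (VV n)) : Set (VV n))) :=
      Submodule.subset_span (by simp)
    have h2 : a.2 ∈ Submodule.span (ZMod 2) ((({a.1, a.2} : Finset (VV n)) : Set (VV n))) :=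
      Submodule.subset_span (by simp)
    constructor
    · intro c hc1 hc2
      exact hv c (Submodule.mem_sup_left hc1) (Submodule.mem_sup_left hc2)
    · intro c hc1 hc2
      rw [add_assoc]
      refine hv (a + c) ?_ ?_
      · exact Submodule.add_mem _ (Submodule.mem_sup_right h1) (Submodule.mem_sup_left hc1)
      · exact Submodule.add_mem _ (Submodule.mem_sup_right h2) (Submodule.mem_sup_left hc2)

lemma unc_iter (n r : ℕ) (C : Submodule (ZMod 2) (VV n)) (j : ℕ) :
    ∃ C' : Submodule (ZMod 2) (VV n),
      Module.finrank (ZMod 2) C' ≤ Module.finrank (ZMod 2) C + 2 * j ∧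
      ((covS n r C')ᶜ.card : ℝ) / Fintype.card (VV n × VV n) ≤
        (((covS n r C)ᶜ.card : ℝ) / Fintype.card (VV n × VV n)) ^ (2 ^ j) := by
  induction j with
  | zero => exact ⟨C, by simp, by simp⟩
  | succ j ih =>
    obtain ⟨C1, h1, h2⟩ := ih
    obtain ⟨C2, h3, h4⟩ := unc_step n r C1
    refine ⟨C2, by omega, ?_⟩
    rw [pow_succ 2 j, pow_mul]
    refine le_trans ?_ (pow_le_pow_left₀ (by positivity) h2 2)
    have hpos : (0 : ℝ) < Fintype.card (VV n × VV n) := by exact_mod_cast Fintype.card_pos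
    rw [div_pow, div_le_div_iff₀ hpos (by positivity)]
    have h4' : ((covS n r C2)ᶜ.card : ℝ) * Fintype.card (VV n × VV n) ≤ (covS n r C1)ᶜ.card ^ 2 := by
      exact_mod_cast h4
    nlinarith

lemma exists_lin {k n : ℕ} (d : VV k × VV k) (h1 : d.1 ≠ 0) (h2 : d.2 ≠ 0) (h3 : d.1 ≠ d.2)
    (x y : VV n) : ∃ L : VV k →ₗ[ZMod 2] VV n, L d.1 = x ∧ L d.2 = y := by
  have hz : ∀ s : ZMod 2, s = 0 ∨ s = 1 := by decide
  have hadd : d.1 + d.2 ≠ 0 := by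
    intro h
    apply h3
    ext j
    have := congrFun h j
    simp only [Pi.add_apply, Pi.zero_apply] at this
    exact (CharTwo.add_eq_zero.mp this)
  have hli : LinearIndependent (ZMod 2) ![d.1, d.2] := by
    rw [LinearIndependent.pair_iff]
    intro s t hst
    rcases hz s with rfl | rfl <;> rcases hz t with rfl | rfl <;> simp_all
  let b := Module.Basis.span hli
  obtain ⟨L, hL⟩ := LinearMap.exists_extend (b.constr (ZMod 2) ![x, y])
  refine ⟨L, ?_, ?_⟩
  · have := LinearMap.congr_fun hL (b 0)
    simp only [Module.Basis.constr_basis] at this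
    simpa [b, Module.Basis.span_apply] using this
  · have := LinearMap.congr_fun hL (b 1)
    simp only [Module.Basis.constr_basis] at this
    simpa [b, Module.Basis.span_apply] using this

lemma exists_lin1 {k n : ℕ} (d : VV k) (h1 : d ≠ 0) 
    (x : VV n) : ∃ L : VV k →ₗ[ZMod 2] VV n, L d = x := by
  obtain ⟨j, hj⟩ := Function.ne_iff.mp h1
  have hz : ∀ s : ZMod 2, s ≠ 0 → s = 1 := by decide
  refine ⟨(LinearMap.proj (R := ZMod 2) (φ := fun _ : Fin k => ZMod 2) j).smulRight x, ?_⟩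
  simp [hz _ hj]

noncomputable instance instFG (k n : ℕ) : Fintype (VV k →ₗ[ZMod 2] VV n) :=
  haveI : Finite (VV k →ₗ[ZMod 2] VV n) := Module.finite_of_finite (ZMod 2)
  Fintype.ofFinite _

def ap {k n : ℕ} (d : VV k × VV k) : (VV k →ₗ[ZMod 2] VV n) →+ VV n × VV n where
  toFun L := (L d.1, L d.2)
  map_zero' := rfl
  map_add' _ _ := rfl

lemma sum_ap_one {k n : ℕ} (r : ℕ) (d : VV k) (hd : d ≠ 0) :
    2 ^ n * ∑ L : VV k →ₗ[ZMod 2] VV n, TT n r (0, L d) =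
      Fintype.card (VV k →ₗ[ZMod 2] VV n) * PP n r := by
  have := sum_hom (A := VV k →ₗ[ZMod 2] VV n) (H := VV n)
    { toFun := fun L => L d, map_zero' := rfl, map_add' := fun _ _ => rfl }
    (exists_lin1 d hd) (fun w => TT n r (0, w))
  simpa [PP] using this

lemma sum_ap_two {k n : ℕ} (r : ℕ) (d : VV k × VV k) (h1 : d.1 ≠ 0) (h2 : d.2 ≠ 0) (h3 : d.1 ≠ d.2) :
    4 ^ n * ∑ L : VV k →ₗ[ZMod 2] VV n, TT n r (ap d L) =
      Fintype.card (VV k →ₗ[ZMod 2] VV n) * (BB n r).card ^ 2 := by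
  have := sum_hom (ap (n := n) d) (fun a => by
    obtain ⟨L, h1, h2⟩ := exists_lin d h1 h2 h3 a.1 a.2
    exact ⟨L, Prod.ext h1 h2⟩) (fun a => TT n r a)
  rw [sum_TT] at this
  rw [← this]
  simp [← mul_pow]

lemma TT_zero (n r : ℕ) : TT n r 0 = (BB n r).card := by
  simp [TT]

lemma sum_ap_le {k n : ℕ} (r : ℕ) (d : VV k × VV k) :
    ((∑ L : VV k →ₗ[ZMod 2] VV n, TT n r (ap d L) : ℕ) : ℝ) ≤
      Fintype.card (VV k →ₗ[ZMod 2] VV n) * 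
        ((if d = 0 then ((BB n r).card : ℝ) else 0) +
         ((if d.1 = 0 then (PP n r : ℝ) / 2 ^ n else 0) + (if d.2 = 0 then (PP n r : ℝ) / 2 ^ n else 0)
          + (if d.1 = d.2 then (PP n r : ℝ) / 2 ^ n else 0)) + (BB n r).card ^ 2 / 4 ^ n) := by
  have hP : ∀ e : VV k, e ≠ 0 → ((∑ L : VV k →ₗ[ZMod 2] VV n, TT n r (0, L e) : ℕ) : ℝ) =
      Fintype.card (VV k →ₗ[ZMod 2] VV n) * ((PP n r : ℝ) / 2 ^ n) := by
    intro e he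
    have := sum_ap_one (n := n) r e he
    field_simp
    exact_mod_cast (mul_comm _ _).trans this
  have h0 : (0:ℝ) ≤ (PP n r : ℝ) / 2 ^ n := by positivity
  have h0' : (0:ℝ) ≤ ((BB n r).card : ℝ) ^ 2 / 4 ^ n := by positivity
  have hN : (0:ℝ) ≤ Fintype.card (VV k →ₗ[ZMod 2] VV n) := by positivity
  obtain ⟨d1, d2⟩ := d
  by_cases h1 : d1 = 0
  · subst h1
    by_cases h2 : d2 = 0
    · subst h2
      have : ∀ L : VV k →ₗ[ZMod 2] VV n, ap (0, 0) L = 0 := fun L => by simp [ap]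
      simp only [this, TT_zero, sum_const, card_univ, smul_eq_mul, Nat.cast_mul]
      gcongr
      simp
      linarith
    · have : ∀ L : VV k →ₗ[ZMod 2] VV n, ap (0, d2) L = (0, L d2) := fun L => by simp [ap]
      simp only [this]
      rw [hP d2 h2]
      gcongr
      simp [h2, Ne.symm h2]
      linarith
  · by_cases h2 : d2 = 0
    · subst h2
      have : ∀ L : VV k →ₗ[ZMod 2] VV n, ap (d1, 0) L = (L d1, 0) := fun L => by simp [ap]
      simp only [this, TT_swap]
      rw [hP d1 h1]
      gcongr
      simp [h1]
      linarith
    · by_cases h3 : d1 = d2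
      · subst h3
        have : ∀ L : VV k →ₗ[ZMod 2] VV n, ap (d1, d1) L = (L d1, L d1) := fun L => by simp [ap]
        simp only [this, TT_diag]
        rw [hP d1 h1]
        gcongr
        simp [h1]
        linarith
      · have := sum_ap_two (n := n) r (d1, d2) h1 h2 h3
        have e : ((∑ L : VV k →ₗ[ZMod 2] VV n, TT n r (ap (d1, d2) L) : ℕ) : ℝ) =
            Fintype.card (VV k →ₗ[ZMod 2] VV n) * (((BB n r).card : ℝ) ^ 2 / 4 ^ n) := by
          field_simp
          exact_mod_cast (mul_comm _ _).trans this
        rw [e]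
        gcongr
        simp [h1, h2, h3]

lemma sum_all_le (k n r : ℕ) :
    ((∑ d : VV k × VV k, ∑ L : VV k →ₗ[ZMod 2] VV n, TT n r (ap d L) : ℕ) : ℝ) ≤
      Fintype.card (VV k →ₗ[ZMod 2] VV n) * 
        ((BB n r).card + 3 * 2 ^ k * (PP n r : ℝ) / 2 ^ n + 4 ^ k * ((BB n r).card ^ 2 / 4 ^ n)) := by
  rw [Nat.cast_sum]
  refine (sum_le_sum fun d _ => sum_ap_le r d).trans ?_
  rw [← mul_sum]
  gcongr
  simp only [sum_add_distrib]
  have e1 : ∑ d : VV k × VV k, (if d.1 = 0 then (PP n r : ℝ) / 2 ^ n else 0) = 2 ^ k * (PP n r / 2 ^ n) := by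
    rw [Fintype.sum_prod_type_right]; simp
  have e2 : ∑ d : VV k × VV k, (if d.2 = 0 then (PP n r : ℝ) / 2 ^ n else 0) = 2 ^ k * (PP n r / 2 ^ n) := by
    rw [Fintype.sum_prod_type]; simp
  have e3 : ∑ d : VV k × VV k, (if d.1 = d.2 then (PP n r : ℝ) / 2 ^ n else 0) = 2 ^ k * (PP n r / 2 ^ n) := by
    rw [Fintype.sum_prod_type]; simp
  rw [e1, e2, e3]
  have e4 : ((Fintype.card (VV k × VV k) : ℕ) : ℝ) = 4 ^ k := by
    simp [← mul_pow]
  simp only [sum_const, card_univ, nsmul_eq_mul, e4]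
  have e5 : ∑ d : VV k × VV k, (if d = 0 then ((BB n r).card : ℝ) else 0) = (BB n r).card := by simp
  rw [e5]
  apply le_of_eq
  ring

open Classical in
noncomputable def NN {k n : ℕ} (r : ℕ) (L : VV k →ₗ[ZMod 2] VV n) (v : VV n × VV n) : ℕ :=
  ∑ u : VV k × VV k, if v + ap u L ∈ BB n r then 1 else 0

lemma ap_sub {k n : ℕ} (L : VV k →ₗ[ZMod 2] VV n) (u d : VV k × VV k) :
    ap (u + d) L = ap u L + ap d L := by
  simp [ap]

lemma sum_NN {k n : ℕ} (r : ℕ) (L : VV k →ₗ[ZMod 2] VV n) :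
    ∑ v, NN r L v = 4 ^ k * (BB n r).card := by
  unfold NN
  rw [sum_comm]
  have : ∀ u : VV k × VV k, ∑ v : VV n × VV n, (if v + ap u L ∈ BB n r then 1 else 0) = (BB n r).card := by
    intro b
    refine (Equiv.sum_comp (Equiv.addRight (ap b L)) (fun a => if a ∈ BB n r then 1 else 0)).trans ?_
    simp
  simp [this, ← mul_pow]

lemma sum_NN_sq {k n : ℕ} (r : ℕ) (L : VV k →ₗ[ZMod 2] VV n) :
    ∑ v, NN r L v ^ 2 = 4 ^ k * ∑ d : VV k × VV k, TT n r (ap d L) := by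
  have h1 : ∀ v, NN r L v ^ 2 = ∑ u : VV k × VV k, ∑ d : VV k × VV k,
      if v + ap u L ∈ BB n r ∧ v + ap u L + ap d L ∈ BB n r then 1 else 0 := by
    intro v
    rw [sq]
    conv_lhs => unfold NN
    rw [sum_mul]
    refine sum_congr rfl fun u _ => ?_
    rw [← Equiv.sum_comp (Equiv.addLeft u) (fun d => if v + ap d L ∈ BB n r then 1 else 0), mul_sum]
    refine sum_congr rfl fun d _ => ?_
    simp only [Equiv.coe_addLeft, ap_sub, add_assoc]
    split_ifs <;> simp_all
  simp_rw [h1]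
  rw [sum_comm]
  have h2 : ∀ u : VV k × VV k, ∑ v : VV n × VV n, ∑ d : VV k × VV k,
      (if v + ap u L ∈ BB n r ∧ v + ap u L + ap d L ∈ BB n r then 1 else 0) =
      ∑ d : VV k × VV k, TT n r (ap d L) := by
    intro u
    rw [sum_comm]
    refine sum_congr rfl fun d _ => ?_
    refine (Equiv.sum_comp (Equiv.addRight (ap u L)) (fun b => if b ∈ BB n r ∧ b + ap d L ∈ BB n r then 1 else 0)).trans ?_
    simp [TT, ← filter_filter]
  rw [sum_congr rfl (fun u _ => h2 u)]
  simp [← mul_pow]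

lemma NN_cov {k n : ℕ} (r : ℕ) (L : VV k →ₗ[ZMod 2] VV n) (v : VV n × VV n)
    (h : v ∉ covS n r (LinearMap.range L)) : NN r L v = 0 := by
  unfold NN
  simp only [covS, mem_filter, mem_univ, true_and, not_exists, not_and] at h
  refine sum_eq_zero fun u _ => ?_
  rw [if_neg]
  exact h _ ⟨u.1, rfl⟩ ⟨u.2, rfl⟩

lemma second_moment (k n r : ℕ) : ∃ C : Submodule (ZMod 2) (VV n),
    Module.finrank (ZMod 2) C ≤ k ∧
    (4:ℝ) ^ k * ((BB n r).card : ℝ) ^ 2 ≤ (covS n r C).card * 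
      ((BB n r).card + 3 * 2 ^ k * (PP n r : ℝ) / 2 ^ n + 4 ^ k * ((BB n r).card ^ 2 / 4 ^ n)) := by
  set K : ℝ := ((BB n r).card + 3 * 2 ^ k * (PP n r : ℝ) / 2 ^ n + 4 ^ k * ((BB n r).card ^ 2 / 4 ^ n)) with hK
  have hCS : ∀ L : VV k →ₗ[ZMod 2] VV n, ((4:ℝ) ^ k * (BB n r).card) ^ 2 ≤
      (covS n r (LinearMap.range L)).card * (4 ^ k * ((∑ d : VV k × VV k, TT n r (ap d L) : ℕ) : ℝ)) := by
    intro L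
    have e1 : (4:ℝ) ^ k * (BB n r).card = ∑ v ∈ covS n r (LinearMap.range L), (NN r L v : ℝ) := by
      rw [sum_subset (subset_univ _) (fun v _ hv => by rw [NN_cov r L v hv]; simp)]
      exact_mod_cast (sum_NN r L).symm
    have e2 : (4:ℝ) ^ k * ((∑ d : VV k × VV k, TT n r (ap d L) : ℕ) : ℝ) = 
        ∑ v ∈ covS n r (LinearMap.range L), (NN r L v : ℝ) ^ 2 := by
      symm
      rw [sum_subset (subset_univ _) (fun v _ hv => by rw [NN_cov r L v hv]; simp)]
      exact_mod_cast (sum_NN_sq r L)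
    rw [e1, e2]
    exact sq_sum_le_card_mul_sum_sq
  by_contra! h
  have hs := sum_all_le k n r
  rw [sum_comm, Nat.cast_sum, ← hK] at hs
  have hL : ∀ L : VV k →ₗ[ZMod 2] VV n, K < ((∑ d : VV k × VV k, TT n r (ap d L) : ℕ) : ℝ) := by
    intro L
    have h1 := h (LinearMap.range L) ((LinearMap.finrank_range_le L).trans (by simp))
    have h2 := hCS L
    set S : ℝ := ((∑ d : VV k × VV k, TT n r (ap d L) : ℕ) : ℝ)
    set c : ℝ := ((covS n r (LinearMap.range L)).card : ℝ)
    have h4 : (0:ℝ) < 4 ^ k := by positivity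
    have h3 : (4:ℝ) ^ k * (BB n r).card ^ 2 ≤ c * S := by
      have : (4:ℝ) ^ k * ((4:ℝ) ^ k * (BB n r).card ^ 2) ≤ 4 ^ k * (c * S) := by nlinarith
      exact le_of_mul_le_mul_left this h4
    have h5 : c * K < c * S := lt_of_lt_of_le h1 h3
    exact lt_of_mul_lt_mul_left h5 (by positivity)
  have := sum_lt_sum_of_nonempty (s := (univ : Finset (VV k →ₗ[ZMod 2] VV n))) ⟨0, mem_univ _⟩
    (fun L _ => hL L)
  simp only [sum_const, card_univ, nsmul_eq_mul] at this
  linarith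

lemma Wt_prod {n : ℕ} {R : Type*} [CommSemiring R] (z : R) (x y : VV n) :
    z ^ Wt (x, y) = ∏ j, (if x j ≠ 0 ∨ y j ≠ 0 then z else 1) := by
  rw [Wt, prod_ite]; simp

lemma sum_prod_fn {n : ℕ} {R : Type*} [CommSemiring R] (g : Fin n → ZMod 2 → R) :
    ∑ x : VV n, ∏ j, g j (x j) = ∏ j, ∑ a : ZMod 2, g j a := by
  rw [Finset.prod_univ_sum]; simp

lemma gen2 {n : ℕ} {R : Type*} [CommSemiring R] (z : R) :
    ∑ v : VV n × VV n, z ^ Wt v = (1 + 3 * z) ^ n := by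
  rw [Fintype.sum_prod_type]
  simp_rw [Wt_prod]
  have h1 : ∀ x : VV n, ∑ y : VV n, ∏ j, (if x j ≠ 0 ∨ y j ≠ 0 then z else 1) =
      ∏ j, ∑ b : ZMod 2, (if x j ≠ 0 ∨ b ≠ 0 then z else 1) := fun x =>
    sum_prod_fn (fun j b => if x j ≠ 0 ∨ b ≠ 0 then z else 1)
  simp_rw [h1]
  rw [sum_prod_fn (fun _ a => ∑ b : ZMod 2, (if a ≠ 0 ∨ b ≠ 0 then z else 1))]
  have : ∑ a : ZMod 2, ∑ b : ZMod 2, (if a ≠ 0 ∨ b ≠ 0 then z else 1) = 1 + 3 * z := by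
    have hu : (univ : Finset (ZMod 2)) = {0, 1} := by decide
    simp [hu]
    ring
  simp [this]

lemma gen3 {n : ℕ} (z : ℝ) :
    ∑ w : VV n, ∑ v : VV n × VV n, z ^ Wt v * z ^ Wt (v + (0, w)) = (1 + 2 * z + 5 * z ^ 2) ^ n := by
  simp_rw [Fintype.sum_prod_type, Prod.mk_add_mk]
  simp_rw [Wt_prod, ← prod_mul_distrib]
  let g : ZMod 2 → ZMod 2 → ZMod 2 → ℝ := fun c a b =>
    (if a ≠ 0 ∨ b ≠ 0 then z else 1) * (if a + 0 ≠ 0 ∨ b + c ≠ 0 then z else 1)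
  have h1 : ∀ w x : VV n, ∑ y : VV n, ∏ j, ((if x j ≠ 0 ∨ y j ≠ 0 then z else 1) * 
      (if (x + 0) j ≠ 0 ∨ (y + w) j ≠ 0 then z else 1)) =
      ∏ j, ∑ b : ZMod 2, g (w j) (x j) b := fun w x =>
    sum_prod_fn (fun j b => g (w j) (x j) b)
  simp_rw [h1]
  have h2 : ∀ w : VV n, ∑ x : VV n, ∏ j, ∑ b : ZMod 2, g (w j) (x j) b =
      ∏ j, ∑ a : ZMod 2, ∑ b : ZMod 2, g (w j) a b := fun w =>
    sum_prod_fn (fun j a => ∑ b : ZMod 2, g (w j) a b)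
  simp_rw [h2]
  rw [sum_prod_fn (fun _ c => ∑ a : ZMod 2, ∑ b : ZMod 2, g c a b)]
  have : ∑ c : ZMod 2, ∑ a : ZMod 2, ∑ b : ZMod 2, g c a b = 1 + 2 * z + 5 * z ^ 2 := by
    have hu : (univ : Finset (ZMod 2)) = {0, 1} := by decide
    have h11 : (1 : ZMod 2) + 1 = 0 := by decide
    simp [hu, g, h11]
    ring
  simp [this]

lemma PP_le (n r : ℕ) (z : ℝ) (hz : 0 < z) (hz1 : z ≤ 1) :
    (PP n r : ℝ) * z ^ (2 * r) ≤ (1 + 2 * z + 5 * z ^ 2) ^ n := by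
  rw [← gen3, PP, Nat.cast_sum, sum_mul]
  refine sum_le_sum fun w _ => ?_
  rw [TT, ← sum_filter_add_sum_filter_not univ (fun v => v ∈ BB n r ∧ v + (0, w) ∈ BB n r)]
  have e : (BB n r).filter (fun b => b + (0, w) ∈ BB n r) = 
    univ.filter (fun v => v ∈ BB n r ∧ v + (0, w) ∈ BB n r) := by ext; simp
  rw [e, ← nsmul_eq_mul]
  have h2 : (0:ℝ) ≤ ∑ v with ¬(v ∈ BB n r ∧ v + (0, w) ∈ BB n r), z ^ Wt v * z ^ Wt (v + (0, w)) :=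
    sum_nonneg fun _ _ => by positivity
  have h1 := card_nsmul_le_sum (univ.filter (fun v => v ∈ BB n r ∧ v + (0, w) ∈ BB n r))
    (fun v => z ^ Wt v * z ^ Wt (v + (0, w))) (z ^ (2 * r)) (by
      intro v hv
      simp only [BB, mem_filter, mem_univ, true_and] at hv
      rw [two_mul, pow_add]
      gcongr ?_ * ?_
      · exact pow_le_pow_of_le_one hz.le hz1 hv.1
      · exact pow_le_pow_of_le_one hz.le hz1 hv.2)
  linarith

lemma BB_ge (n r : ℕ) : n.choose r * 3 ^ r ≤ (BB n r).card := by
  have h := gen2 (n := n) (Polynomial.X : Polynomial ℕ)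
  have h2 := congrArg (fun p => Polynomial.coeff p r) h
  simp only [Polynomial.finsetSum_coeff, Polynomial.coeff_X_pow] at h2
  have h3 : ((1 + 3 * Polynomial.X : Polynomial ℕ) ^ n).coeff r = n.choose r * 3 ^ r := by
    have : (1 + 3 * Polynomial.X : Polynomial ℕ) ^ n = ((1 + Polynomial.X) ^ n).comp (Polynomial.C 3 * Polynomial.X) := by
      simp
    rw [this, Polynomial.comp_C_mul_X_coeff, Polynomial.coeff_one_add_X_pow]
    simp
  rw [h3] at h2
  rw [← h2, ← card_filter, BB]
  apply card_le_card
  intro v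
  simp only [mem_filter, mem_univ, true_and]
  intro h; omega

lemma fact_aux (r i : ℕ) : r.factorial * r ^ i ≤ i.factorial * r ^ r := by
  rcases le_total r i with h | h
  · obtain ⟨m, rfl⟩ := Nat.exists_eq_add_of_le h
    have : r.factorial * r ^ m ≤ (r + m).factorial :=
      le_trans (by gcongr; omega) (Nat.factorial_mul_pow_le_factorial (n := m) (m := r))
    calc r.factorial * r ^ (r + m) = r.factorial * r ^ m * r ^ r := by ring
      _ ≤ _ := by gcongr
  · obtain ⟨m, rfl⟩ := Nat.exists_eq_add_of_le h
    have h2 : (i + m).factorial ≤ i.factorial * (i + m) ^ m := by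
      have := Nat.factorial_mul_descFactorial (n := i + m) (k := m) (by omega)
      rw [← this]
      simp
      gcongr
      exact Nat.descFactorial_le_pow _ _
    calc (i + m).factorial * (i + m) ^ i ≤ i.factorial * (i + m) ^ m * (i + m) ^ i := by gcongr
      _ = _ := by ring

lemma choose_ge (r s : ℕ) : (r + s) ^ (r + s) ≤ (r + s + 1) * ((r + s).choose r * r ^ r * s ^ s) := by
  have hterm : ∀ i ∈ range (r + s + 1), r ^ i * s ^ (r + s - i) * (r + s).choose i ≤
      (r + s).choose r * r ^ r * s ^ s := by
    intro i hi
    have hi' : i ≤ r + s := by simp at hi; omega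
    obtain ⟨j, hj⟩ := Nat.exists_eq_add_of_le hi'
    have e1 : r + s - i = j := by omega
    rw [e1]
    have f1 := fact_aux r i
    have f2 := fact_aux s j
    have c1 : (r + s).choose i * i.factorial * j.factorial = (r + s).factorial := by
      rw [hj, Nat.choose_symm_add]; exact Nat.add_choose_mul_factorial_mul_factorial i j
    have c2 : (r + s).choose r * r.factorial * s.factorial = (r + s).factorial := by
      rw [Nat.choose_symm_add]; exact Nat.add_choose_mul_factorial_mul_factorial r s
    have hp : 0 < r.factorial * s.factorial * (i.factorial * j.factorial) := by positivity
    refine le_of_mul_le_mul_right ?_ hp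
    calc r ^ i * s ^ j * (r + s).choose i * (r.factorial * s.factorial * (i.factorial * j.factorial))
        = ((r + s).choose i * i.factorial * j.factorial) * ((r.factorial * r ^ i) * (s.factorial * s ^ j)) := by ring
      _ ≤ ((r + s).choose i * i.factorial * j.factorial) * ((i.factorial * r ^ r) * (j.factorial * s ^ s)) := by gcongr
      _ = ((r + s).choose r * r.factorial * s.factorial) * ((i.factorial * r ^ r) * (j.factorial * s ^ s)) := by rw [c1, c2]
      _ = _ := by ring
  rw [add_pow]
  refine (sum_le_sum hterm).trans ?_
  simp

noncomputable def gg (x : ℝ) : ℝ := x * Real.log 3 + Real.binEntropy x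

lemma gg_cont : Continuous gg := by unfold gg; fun_prop

lemma qEnt_four (x : ℝ) : qEnt 4 x = gg x / (2 * Real.log 2) := by
  have h4 : Real.log 4 = 2 * Real.log 2 := by
    rw [show (4:ℝ) = 2 ^ 2 by norm_num, Real.log_pow]; norm_num
  unfold qEnt gg Real.binEntropy Real.logb
  rw [Real.log_inv, Real.log_inv]
  norm_num
  rw [h4]
  ring

lemma qEnt_two (x : ℝ) : qEnt 2 x = Real.binEntropy x / Real.log 2 := by
  unfold qEnt Real.binEntropy Real.logb
  rw [Real.log_inv, Real.log_inv]
  norm_num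
  ring

lemma gibbs (ρ w : ℝ) (h0 : 0 < ρ) (h1 : ρ < 1) (hw : 0 < w) :
    gg ρ ≤ Real.log (1 + 3 * w) - ρ * Real.log w := by
  have h2 : 0 < 1 - ρ := by linarith
  have hS : 0 < 1 + 3 * w := by positivity
  have a1 := Real.log_le_sub_one_of_pos (x := 3 * w / (ρ * (1 + 3 * w))) (by positivity)
  have a2 := Real.log_le_sub_one_of_pos (x := 1 / ((1 - ρ) * (1 + 3 * w))) (by positivity)
  have b1 := mul_le_mul_of_nonneg_left a1 h0.le
  have b2 := mul_le_mul_of_nonneg_left a2 h2.le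
  rw [Real.log_div (by positivity) (by positivity), Real.log_mul (by norm_num) hw.ne', Real.log_mul h0.ne' hS.ne'] at b1
  rw [Real.log_div (by positivity) (by positivity), Real.log_one, Real.log_mul h2.ne' hS.ne'] at b2
  have e : ρ * (3 * w / (ρ * (1 + 3 * w)) - 1) + (1 - ρ) * (1 / ((1 - ρ) * (1 + 3 * w)) - 1) = 0 := by
    field_simp
    ring
  unfold gg Real.binEntropy
  rw [Real.log_inv, Real.log_inv]
  nlinarith

lemma poly_ineq (t : ℝ) (h0 : 0 ≤ t) (h1 : t ≤ 1) :
    (1 + 3 * t ^ 4) ^ 3 ≤ (1 + 2 * t ^ 3 + 5 * (t ^ 3) ^ 2) ^ 2 := by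
  have h : (1 + 2 * t ^ 3 + 5 * (t ^ 3) ^ 2) ^ 2 - (1 + 3 * t ^ 4) ^ 3 =
      t ^ 3 * ((1 - t) ^ 3 * (1 + 3 * t + 3 * (1 - t ^ 2) + 12 * t ^ 4 + 6 * t ^ 5 + 2 * t ^ 6)) := by ring
  have h2 : 0 ≤ 1 - t := by linarith
  have h3 : 0 ≤ 1 - t ^ 2 := by nlinarith
  have : 0 ≤ t ^ 3 * ((1 - t) ^ 3 * (1 + 3 * t + 3 * (1 - t ^ 2) + 12 * t ^ 4 + 6 * t ^ 5 + 2 * t ^ 6)) := by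
    positivity
  linarith

lemma f2_bdd (ρ : ℝ) (h1 : ρ < 1) : BddAbove { y : ℝ | ∃ α β : ℝ, 0 ≤ α ∧ α ≤ ρ ∧ 0 ≤ β ∧ β ≤ ρ - α ∧
    y = qEnt 2 α + 2 * (1 - α) * qEnt 2 (β / (1 - α)) + 2 * α } := by
  refine ⟨5, ?_⟩
  rintro y ⟨α, β, ha, hb, -, -, rfl⟩
  have h2 : 0 < Real.log 2 := Real.log_pos (by norm_num)
  have hq : ∀ x, qEnt 2 x ≤ 1 := fun x => by
    rw [qEnt_two, div_le_one h2]; exact Real.binEntropy_le_log_two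
  have := hq α
  have := mul_le_mul_of_nonneg_left (hq (β / (1 - α))) (show 0 ≤ 2 * (1 - α) by linarith)
  linarith

lemma exists_t (ρ : ℝ) (h0 : 0 < ρ) (h1 : ρ < 3 / 4) : ∃ t : ℝ, 0 < t ∧ t ≤ 1 ∧
    ρ = (t ^ 3 + 5 * (t ^ 3) ^ 2) / (1 + 2 * t ^ 3 + 5 * (t ^ 3) ^ 2) := by
  have hc : ContinuousOn (fun t : ℝ => (t ^ 3 + 5 * (t ^ 3) ^ 2) / (1 + 2 * t ^ 3 + 5 * (t ^ 3) ^ 2)) (Set.Icc 0 1) := by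
    apply ContinuousOn.div
    · fun_prop
    · fun_prop
    · rintro t ⟨ht, -⟩
      positivity
  have := intermediate_value_Icc (zero_le_one) hc
  obtain ⟨t, ⟨ht0, ht1⟩, ht⟩ := this (show ρ ∈ _ by constructor <;> norm_num <;> linarith)
  refine ⟨t, lt_of_le_of_ne ht0 ?_, ht1, ht.symm⟩
  rintro rfl
  norm_num at ht
  linarith

lemma f2_ge (ρ z : ℝ) (h1 : ρ < 1) (hz : 0 < z) 
    (h : ρ = (z + 5 * z ^ 2) / (1 + 2 * z + 5 * z ^ 2)) :
    (Real.log (1 + 2 * z + 5 * z ^ 2) - 2 * ρ * Real.log z) / Real.log 2 ≤ f2 ρ := by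
  have hl : 0 < Real.log 2 := Real.log_pos (by norm_num)
  have hP : 0 < 1 + 2 * z + 5 * z ^ 2 := by positivity
  have hz1 : 0 < 1 + z := by positivity
  refine le_csSup (f2_bdd ρ h1) ⟨4 * z ^ 2 / (1 + 2 * z + 5 * z ^ 2), (z + z ^ 2) / (1 + 2 * z + 5 * z ^ 2), by positivity, ?_, by positivity, ?_, ?_⟩
  · rw [h]; gcongr; nlinarith
  · rw [h, ← sub_div]; gcongr; nlinarith
  · have e1 : 1 - 4 * z ^ 2 / (1 + 2 * z + 5 * z ^ 2) = (1 + z) ^ 2 / (1 + 2 * z + 5 * z ^ 2) := by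
      field_simp; ring
    have e2 : (z + z ^ 2) / (1 + 2 * z + 5 * z ^ 2) / (1 - 4 * z ^ 2 / (1 + 2 * z + 5 * z ^ 2)) = z / (1 + z) := by
      rw [e1]; field_simp
    have e3 : 1 - z / (1 + z) = 1 / (1 + z) := by field_simp; ring
    rw [e2, qEnt_two, qEnt_two]
    unfold Real.binEntropy
    rw [e3, e1]
    simp only [Real.log_inv]
    rw [Real.log_div (by positivity) hP.ne', Real.log_div (by positivity) hP.ne',
      Real.log_div (by positivity) hz1.ne', Real.log_div (by positivity) hz1.ne', Real.log_one,
      Real.log_mul (by norm_num) (by positivity), Real.log_pow, Real.log_pow,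
      show (4:ℝ) = 2 ^ 2 by norm_num, Real.log_pow, h]
    push_cast
    generalize Real.log (1 + 2 * z + 5 * z ^ 2) = p
    generalize Real.log z = q
    generalize Real.log (1 + z) = s
    generalize Real.log 2 = l at *
    field_simp
    ring

lemma analytic (ρ : ℝ) (h0 : 0 < ρ) (h1 : ρ < 3 / 4) : ∃ φ : ℝ, φ ≤ f2 ρ ∧
    3 / 2 * gg ρ ≤ φ * Real.log 2 ∧ 
    ∀ n : ℕ, (PP n ⌊ρ * n⌋₊ : ℝ) ≤ Real.exp (φ * Real.log 2 * n) := by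
  have hl : 0 < Real.log 2 := Real.log_pos (by norm_num)
  obtain ⟨t, ht0, ht1, ht⟩ := exists_t ρ h0 h1
  refine ⟨_, f2_ge ρ (t ^ 3) (by linarith) (by positivity) ht, ?_, ?_⟩
  · rw [div_mul_cancel₀ _ hl.ne']
    have g := gibbs ρ (t ^ 4) h0 (by linarith) (by positivity)
    have hp := Real.log_le_log (by positivity) (poly_ineq t ht0.le ht1)
    rw [Real.log_pow, Real.log_pow] at hp
    rw [Real.log_pow] at g ⊢
    push_cast at *
    linarith
  · intro n
    rw [div_mul_cancel₀ _ hl.ne']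
    have hz : 0 < t ^ 3 := by positivity
    have hz1 : t ^ 3 ≤ 1 := pow_le_one₀ ht0.le ht1
    have hb := PP_le n ⌊ρ * n⌋₊ (t ^ 3) hz hz1
    rw [← le_div_iff₀ (by positivity)] at hb
    refine hb.trans ?_
    rw [← Real.exp_log (show 0 < (1 + 2 * t ^ 3 + 5 * (t ^ 3) ^ 2) ^ n / (t ^ 3) ^ (2 * ⌊ρ * n⌋₊) by positivity)]
    rw [Real.exp_le_exp, Real.log_div (by positivity) (by positivity), Real.log_pow, Real.log_pow]
    have hf : (⌊ρ * n⌋₊ : ℝ) ≤ ρ * n := Nat.floor_le (by positivity)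
    have hlz : Real.log (t ^ 3) ≤ 0 := Real.log_nonpos hz.le hz1
    push_cast
    nlinarith

lemma BB_log (n r : ℕ) (hn : 0 < n) (hr : r ≤ n) :
    Real.exp (n * gg (r / n) - Real.log (n + 1)) ≤ (BB n r).card := by
  obtain ⟨s, rfl⟩ := Nat.exists_eq_add_of_le hr
  have h1 := choose_ge r s
  have h2 := BB_ge (r + s) r
  have h3 : (((r + s : ℕ) : ℝ)) ^ (r + s) * 3 ^ r ≤ ((r + s : ℕ) + 1) * (BB (r + s) r).card * ((r:ℝ) ^ r * (s:ℝ) ^ s) := by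
    have : (r + s) ^ (r + s) * 3 ^ r ≤ (r + s + 1) * (BB (r + s) r).card * (r ^ r * s ^ s) := by
      calc (r + s) ^ (r + s) * 3 ^ r ≤ (r + s + 1) * ((r + s).choose r * r ^ r * s ^ s) * 3 ^ r := by gcongr
        _ = (r + s + 1) * ((r + s).choose r * 3 ^ r) * (r ^ r * s ^ s) := by ring
        _ ≤ _ := by gcongr
    exact_mod_cast this
  have hpos : ∀ m : ℕ, (0:ℝ) < (m:ℝ) ^ m := by
    intro m
    rcases Nat.eq_zero_or_pos m with rfl | h
    · simp
    · positivity
  have hN : (0:ℝ) < ((r + s : ℕ) : ℝ) := by exact_mod_cast hn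
  have hB : (0:ℝ) < (BB (r + s) r).card := by
    have : 0 < (r + s).choose r * 3 ^ r := by
      have := Nat.choose_pos (Nat.le_add_right r s)
      positivity
    exact_mod_cast lt_of_lt_of_le this h2
  rw [← Real.exp_log hB, Real.exp_le_exp]
  have h4 := Real.log_le_log (by have := hpos (r + s); positivity) h3
  have pr := hpos r
  have ps := hpos s
  rw [Real.log_mul (hpos _).ne' (by positivity), Real.log_mul (by positivity) (by positivity),
    Real.log_mul (by positivity) hB.ne', Real.log_mul pr.ne' ps.ne', Real.log_pow, Real.log_pow, Real.log_pow, Real.log_pow] at h4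
  have e : ((r + s : ℕ) : ℝ) * gg (r / (r + s : ℕ)) = (r + s : ℕ) * Real.log (r + s : ℕ) + r * Real.log 3 - (r * Real.log r + s * Real.log s) := by
    have e1 : (1:ℝ) - r / (r + s : ℕ) = s / (r + s : ℕ) := by
      field_simp; push_cast; ring
    have hlog : ∀ m : ℕ, (m:ℝ) * Real.log (m / (r + s : ℕ)) = m * (Real.log m - Real.log (r + s : ℕ)) := by
      intro m
      rcases Nat.eq_zero_or_pos m with rfl | h
      · simp
      · rw [Real.log_div (by positivity) hN.ne']
    unfold gg Real.binEntropy
    rw [e1, Real.log_inv, Real.log_inv]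
    have l1 := hlog r
    have l2 := hlog s
    generalize Real.log (r / (r + s : ℕ)) = x at *
    generalize Real.log (s / (r + s : ℕ)) = y at *
    have : ((r + s : ℕ) : ℝ) * (r / (r + s : ℕ) * Real.log 3 + (r / (r + s : ℕ) * -x + s / (r + s : ℕ) * -y)) = r * Real.log 3 - r * x - s * y := by
      field_simp
      ring
    rw [this, l1, l2]
    push_cast
    ring
  rw [e]
  linarith

lemma kMin_le_of_cov (n r' r : ℕ) (hr : r' ≤ r) (C : Submodule (ZMod 2) (VV n))
    (h : covS n r' C = univ) : kMin (ZMod 2) 2 n r ≤ Module.finrank (ZMod 2) C := by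
  refine Nat.sInf_le ⟨C, rfl, le_trans (Nat.sInf_le ?_) hr⟩
  intro v
  have hv : (v 0, v 1) ∈ covS n r' C := by rw [h]; exact mem_univ _
  simp only [covS, mem_filter, mem_univ, true_and] at hv
  obtain ⟨c, hc1, hc2, hc⟩ := hv
  refine ⟨Matrix.of ![-c.1, -c.2], ?_, ?_⟩
  · intro i
    fin_cases i
    · exact C.neg_mem hc1
    · exact C.neg_mem hc2
  · simp only [BB, mem_filter, mem_univ, true_and] at hc
    show twt _ ≤ r'
    refine le_trans (le_of_eq ?_) hc
    unfold twt Wt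
    rw [← Set.ncard_coe_finset]
    congr 1
    ext j
    simp [Fin.exists_fin_two, CharTwo.sub_eq_add]

lemma kMin_le_finite (n r' r k : ℕ) (hn : 0 < n) (hr : r' ≤ r) (K : ℝ) (hK : 1 ≤ K)
    (hB : 0 < (BB n r').card)
    (h : (4:ℝ) ^ n / 4 ^ k / (BB n r').card + 3 * (2 ^ n / 2 ^ k * (PP n r') / ((BB n r').card) ^ 2) + 1 ≤ K) :
    (kMin (ZMod 2) 2 n r : ℝ) ≤ k + 2 * (Real.logb 2 (2 * n * K) + 1) := by
  obtain ⟨C, hC, hc⟩ := second_moment k n r'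
  set j := ⌈Real.logb 2 (2 * n * K)⌉₊ with hj
  obtain ⟨C', hC', hc'⟩ := unc_iter n r' C j
  have hn' : (1:ℝ) ≤ n := by exact_mod_cast hn
  have hnK : 1 ≤ 2 * n * K := by nlinarith
  have hlog : 0 ≤ Real.logb 2 (2 * n * K) := Real.logb_nonneg (by norm_num) hnK
  have hj1 : (j:ℝ) ≤ Real.logb 2 (2 * n * K) + 1 := (Nat.ceil_lt_add_one hlog).le
  have hj2 : 2 * n * K ≤ (2:ℝ) ^ j := by
    have : Real.logb 2 (2 * n * K) ≤ j := Nat.le_ceil _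
    rw [Real.logb_le_iff_le_rpow (by norm_num) (by linarith)] at this
    simpa using this
  have hA : ((Fintype.card (VV n × VV n) : ℕ) : ℝ) = 4 ^ n := by simp [← mul_pow]
  have hB' : (0:ℝ) < (BB n r').card := by exact_mod_cast hB
  have hcov : (4:ℝ) ^ n ≤ (covS n r' C).card * K := by
    set b : ℝ := ((BB n r').card : ℝ)
    have e : (4:ℝ) ^ n / 4 ^ k / b + 3 * (2 ^ n / 2 ^ k * (PP n r') / b ^ 2) + 1 = 
      (b + 3 * 2 ^ k * (PP n r' : ℝ) / 2 ^ n + 4 ^ k * (b ^ 2 / 4 ^ n)) * 4 ^ n / (4 ^ k * b ^ 2) := by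
      have e4 : ∀ m : ℕ, (4:ℝ) ^ m = 2 ^ m * 2 ^ m := fun m => by rw [← mul_pow]; norm_num
      rw [e4, e4]
      field_simp
    rw [e] at h
    have hp : (0:ℝ) < 4 ^ k * b ^ 2 := by positivity
    rw [div_le_iff₀ hp] at h
    have h4 : (0:ℝ) < 4 ^ n := by positivity
    have hc0 : (0:ℝ) ≤ (covS n r' C).card := by positivity
    have a1 := mul_le_mul_of_nonneg_left h hc0
    have a2 := mul_le_mul_of_nonneg_right hc h4.le
    have : (4:ℝ) ^ n * (4 ^ k * b ^ 2) ≤ (covS n r' C).card * K * (4 ^ k * b ^ 2) := by linarith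
    exact le_of_mul_le_mul_right this hp
  have hunc : ((covS n r' C)ᶜ.card : ℝ) = 4 ^ n - (covS n r' C).card := by
    have := card_add_card_compl (covS n r' C)
    rw [← hA, ← this]; push_cast; ring
  have hK0 : 0 < K := by linarith
  have hfr : ((covS n r' C)ᶜ.card : ℝ) / 4 ^ n ≤ Real.exp (-(1 / K)) := by
    have h4 : (0:ℝ) < 4 ^ n := by positivity
    have : ((covS n r' C)ᶜ.card : ℝ) / 4 ^ n ≤ 1 - 1 / K := by
      rw [hunc, sub_div, div_self h4.ne']
      have : 1 / K ≤ (covS n r' C).card / 4 ^ n := by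
        rw [div_le_div_iff₀ hK0 h4]; linarith
      linarith
    have := Real.add_one_le_exp (-(1 / K))
    linarith
  have hlt : ((covS n r' C')ᶜ.card : ℝ) < 1 := by
    rw [hA] at hc'
    have h4 : (0:ℝ) < 4 ^ n := by positivity
    have a1 := hc'.trans (pow_le_pow_left₀ (by positivity) hfr _)
    rw [← Real.exp_nat_mul] at a1
    have a2 : ((2 ^ j : ℕ) : ℝ) * -(1 / K) ≤ -(2 * n) := by
      push_cast
      have : 2 * n ≤ (2:ℝ) ^ j / K := by rw [le_div_iff₀ hK0]; exact hj2
      have e : (2:ℝ) ^ j * -(1 / K) = -((2:ℝ) ^ j / K) := by ring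
      rw [e]; linarith
    have a3 := a1.trans (Real.exp_le_exp.mpr a2)
    rw [div_le_iff₀ h4] at a3
    refine lt_of_le_of_lt a3 ?_
    have h2 : Real.log 4 < 2 := by
      rw [show (4:ℝ) = 2 ^ 2 by norm_num, Real.log_pow]
      have := Real.log_two_lt_d9
      push_cast; linarith
    have e4 : (4:ℝ) ^ n = Real.exp (n * Real.log 4) := by
      rw [Real.exp_nat_mul, Real.exp_log (by norm_num)]
    rw [e4, ← Real.exp_add, Real.exp_lt_one_iff]
    nlinarith
  have hz : (covS n r' C')ᶜ.card = 0 := by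
    have : (covS n r' C')ᶜ.card < 1 := by exact_mod_cast hlt
    omega
  rw [card_eq_zero, compl_eq_empty_iff] at hz
  have hfin := kMin_le_of_cov n r' r hr C' hz
  have : kMin (ZMod 2) 2 n r ≤ k + 2 * j := by omega
  have : (kMin (ZMod 2) 2 n r : ℝ) ≤ k + 2 * j := by exact_mod_cast this
  linarith

lemma kMin_le_n (n r : ℕ) : kMin (ZMod 2) 2 n r ≤ n := by
  refine (kMin_le_of_cov n 0 r (Nat.zero_le _) ⊤ ?_).trans (by simp)
  ext v
  simp only [covS, mem_filter, mem_univ, true_and, iff_true, Submodule.mem_top]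
  refine ⟨-v, ?_⟩
  simp [BB, Wt]

lemma bdd_below (ρ : ℝ) : Filter.IsBoundedUnder (· ≥ ·) Filter.atTop
    (fun n : ℕ => (kMin (ZMod 2) 2 n ⌊ρ * n⌋₊ : ℝ) / n) :=
  Filter.isBoundedUnder_of ⟨0, fun n => by positivity⟩

lemma kMin_div_le_one (n r : ℕ) : (kMin (ZMod 2) 2 n r : ℝ) / n ≤ 1 := by
  have : (kMin (ZMod 2) 2 n r : ℝ) ≤ n := by exact_mod_cast kMin_le_n n r
  exact div_le_one_of_le₀ this (by positivity)

lemma kappa_le_of_ev (ρ c : ℝ)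
    (h : ∀ᶠ n : ℕ in Filter.atTop, (kMin (ZMod 2) 2 n ⌊ρ * n⌋₊ : ℝ) / n ≤ c) :
    kappa (ZMod 2) 2 ρ ≤ c :=
  Filter.liminf_le_of_frequently_le h.frequently (bdd_below ρ)

lemma kappa_nonneg (ρ : ℝ) : 0 ≤ kappa (ZMod 2) 2 ρ := by
  refine Filter.le_liminf_of_le ?_ (Filter.Eventually.of_forall fun n => by positivity)
  apply Filter.IsBoundedUnder.isCoboundedUnder_ge
  exact Filter.isBoundedUnder_of ⟨1, fun n => kMin_div_le_one _ _⟩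

lemma main_asymp (ρ' ρ c φ : ℝ) (h0 : 0 ≤ ρ') (h1 : ρ' ≤ 1) (hρ : ρ' ≤ ρ) (hc : 0 ≤ c)
    (hP : ∀ n : ℕ, (PP n ⌊ρ' * n⌋₊ : ℝ) ≤ Real.exp (φ * Real.log 2 * n))
    (e1 : (1 - c + φ) * Real.log 2 - 2 * gg ρ' ≤ 0)
    (e2 : (2 - 2 * c) * Real.log 2 - gg ρ' ≤ 0) :
    kappa (ZMod 2) 2 ρ ≤ c := by
  suffices H : ∀ ε : ℝ, 0 < ε → kappa (ZMod 2) 2 ρ ≤ c + 17 * ε by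
    refine le_of_forall_pos_le_add fun ε hε => ?_
    have := H (ε / 17) (by positivity)
    linarith
  intro ε hε
  apply kappa_le_of_ev
  have t1 : Filter.Tendsto (fun n : ℕ => gg ((⌊ρ' * n⌋₊ : ℝ) / n)) Filter.atTop (nhds (gg ρ')) :=
    (gg_cont.tendsto ρ').comp ((tendsto_nat_floor_mul_div_atTop h0).comp tendsto_natCast_atTop_atTop)
  have t2 : Filter.Tendsto (fun n : ℕ => (Real.log n) / n) Filter.atTop (nhds 0) := by
    have : Filter.Tendsto (fun x : ℝ => Real.log x / x) Filter.atTop (nhds 0) :=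
      Real.isLittleO_log_id_atTop.tendsto_div_nhds_zero
    exact this.comp tendsto_natCast_atTop_atTop
  have t3 : Filter.Tendsto (fun n : ℕ => (3 + 4 * Real.log 10) / (n:ℝ)) Filter.atTop (nhds 0) :=
    tendsto_const_div_atTop_nhds_zero_nat _
  filter_upwards [t1.eventually (lt_mem_nhds (show gg ρ' - ε < gg ρ' by linarith)),
    t2.eventually (gt_mem_nhds (show 0 < ε / 8 by positivity)),
    t3.eventually (gt_mem_nhds (show 0 < ε / 2 by positivity)),
    Filter.eventually_gt_atTop 0] with n a1 a2 a3 hn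
  have hn' : (0:ℝ) < n := by exact_mod_cast hn
  have hn1 : (1:ℝ) ≤ n := by exact_mod_cast hn
  rw [div_lt_iff₀ hn'] at a2 a3
  set r' := ⌊ρ' * n⌋₊ with hr'
  have hl : 0 < Real.log 2 := Real.log_pos (by norm_num)
  have hl2 : 1 / 2 < Real.log 2 := by have := Real.log_two_gt_d9; linarith
  have hr'n : r' ≤ n := by
    apply Nat.floor_le_of_le
    nlinarith
  have hb := BB_log n r' hn hr'n
  have hlogn : Real.log (n + 1) ≤ ε * n := by
    have : Real.log (n + 1) ≤ Real.log (10 * n) := Real.log_le_log (by positivity) (by linarith)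
    rw [Real.log_mul (by norm_num) hn'.ne'] at this
    have : 0 ≤ Real.log 10 := Real.log_nonneg (by norm_num)
    linarith
  have hb2 : Real.exp (n * (gg ρ' - 2 * ε)) ≤ (BB n r').card := by
    refine le_trans (Real.exp_le_exp.mpr ?_) hb
    nlinarith
  have hBpos : 0 < (BB n r').card := by
    have := lt_of_lt_of_le (Real.exp_pos _) hb
    exact_mod_cast this
  set k := ⌈c * n⌉₊ with hk
  have hk1 : c * n ≤ k := Nat.le_ceil _
  have hk2 : (k:ℝ) ≤ c * n + 1 := (Nat.ceil_lt_add_one (by positivity)).le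
  have p2 : ∀ m : ℕ, (2:ℝ) ^ m = Real.exp (m * Real.log 2) := fun m => by
    rw [Real.exp_nat_mul, Real.exp_log (by norm_num)]
  have p4 : ∀ m : ℕ, (4:ℝ) ^ m = Real.exp (m * (2 * Real.log 2)) := fun m => by
    rw [Real.exp_nat_mul, show (2 * Real.log 2) = Real.log 4 by
      rw [show (4:ℝ) = 2 ^ 2 by norm_num, Real.log_pow]; push_cast; ring, Real.exp_log (by norm_num)]
  have hkl : c * n * Real.log 2 ≤ k * Real.log 2 := by gcongr
  have hεn : 0 < ε * n := by positivity
  have q1 : (4:ℝ) ^ n / 4 ^ k / (BB n r').card ≤ Real.exp (4 * ε * n) := by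
    calc (4:ℝ) ^ n / 4 ^ k / (BB n r').card ≤ (4:ℝ) ^ n / 4 ^ k / Real.exp (n * (gg ρ' - 2 * ε)) := by gcongr
      _ = Real.exp (n * (2 * Real.log 2) - k * (2 * Real.log 2) - n * (gg ρ' - 2 * ε)) := by
        rw [p4, p4, Real.exp_sub, Real.exp_sub]
      _ ≤ _ := by
        rw [Real.exp_le_exp]
        have := mul_le_mul_of_nonneg_right e2 hn'.le
        nlinarith
  have q2 : (2:ℝ) ^ n / 2 ^ k * (PP n r') / ((BB n r').card) ^ 2 ≤ Real.exp (4 * ε * n) := by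
    calc (2:ℝ) ^ n / 2 ^ k * (PP n r') / ((BB n r').card) ^ 2 
        ≤ (2:ℝ) ^ n / 2 ^ k * Real.exp (φ * Real.log 2 * n) / (Real.exp (n * (gg ρ' - 2 * ε))) ^ 2 := by
          gcongr
          exact hP n
      _ = Real.exp (n * Real.log 2 - k * Real.log 2 + φ * Real.log 2 * n - (2 : ℕ) * (n * (gg ρ' - 2 * ε))) := by
        rw [p2, p2, Real.exp_sub, Real.exp_add, Real.exp_sub, Real.exp_nat_mul (n * (gg ρ' - 2 * ε)) 2]
      _ ≤ _ := by
        rw [Real.exp_le_exp]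
        have := mul_le_mul_of_nonneg_right e1 hn'.le
        push_cast
        nlinarith
  have q3 : 1 ≤ Real.exp (4 * ε * n) := Real.one_le_exp (by positivity)
  have fin := kMin_le_finite n r' ⌊ρ * n⌋₊ k hn (Nat.floor_le_floor (by gcongr)) 
    (5 * Real.exp (4 * ε * n)) (by linarith) hBpos (by linarith)
  rw [div_le_iff₀ hn']
  have hlb : Real.logb 2 (2 * n * (5 * Real.exp (4 * ε * n))) ≤ 2 * (Real.log 10 + Real.log n + 4 * ε * n) := by
    rw [show 2 * (n:ℝ) * (5 * Real.exp (4 * ε * n)) = 10 * n * Real.exp (4 * ε * n) by ring, Real.logb,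
      Real.log_mul (by positivity) (by positivity), Real.log_mul (by norm_num) hn'.ne', Real.log_exp,
      div_le_iff₀ hl]
    have : 0 ≤ Real.log 10 + Real.log n + 4 * ε * n := by
      have := Real.log_nonneg hn1
      have : 0 ≤ Real.log 10 := Real.log_nonneg (by norm_num)
      positivity
    nlinarith
  linarith

end Helpers

theorem stmt14 :
    (∀ ρ : ℝ, 0 ≤ ρ → ρ < 3 / 4 →
      kappa (ZMod 2) 2 ρ ≤ 1 - (4 * qEnt 4 ρ - max (f1 ρ) (f2 ρ))) ∧
    (∀ ρ : ℝ, 3 / 4 ≤ ρ → ρ ≤ 1 → kappa (ZMod 2) 2 ρ = 0) := by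
  have hl : 0 < Real.log 2 := Real.log_pos (by norm_num)
  constructor
  · intro ρ h0 h1
    rcases h0.eq_or_lt with rfl | h0
    · have a : kappa (ZMod 2) 2 0 ≤ 1 :=
        kappa_le_of_ev _ _ (Filter.Eventually.of_forall fun n => kMin_div_le_one _ _)
      have b : 0 ≤ f2 0 := le_csSup (f2_bdd 0 (by norm_num)) ⟨0, 0, by simp [qEnt_two]⟩
      have c : qEnt 4 0 = 0 := by simp [qEnt_four, gg]
      have d := le_max_right (f1 0) (f2 0)
      rw [c]; linarith
    · obtain ⟨φ, p1, p2, p3⟩ := analytic ρ h0 h1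
      have d := le_max_right (f1 ρ) (f2 ρ)
      set f := max (f1 ρ) (f2 ρ)
      have q : 4 * qEnt 4 ρ * Real.log 2 = 2 * gg ρ := by
        rw [qEnt_four]; field_simp; ring
      have g4 : gg ρ ≤ 2 * Real.log 2 := by
        have := gibbs ρ 1 h0 (by linarith) one_pos
        rw [Real.log_one, show (1:ℝ) + 3 * 1 = 2 ^ 2 by norm_num, Real.log_pow] at this
        push_cast at this
        linarith
      have hf : φ * Real.log 2 ≤ f * Real.log 2 := by gcongr; linarith
      apply main_asymp ρ ρ _ φ h0.le (by linarith) le_rfl ?_ p3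
      · nlinarith
      · nlinarith
      · have : 0 ≤ (1 - (4 * qEnt 4 ρ - f)) * Real.log 2 := by nlinarith
        exact nonneg_of_mul_nonneg_left this hl
  · intro ρ h0 h1
    refine le_antisymm ?_ (kappa_nonneg ρ)
    have g34 : gg (3 / 4) = 2 * Real.log 2 := by
      unfold gg Real.binEntropy
      rw [Real.log_inv, Real.log_inv, show (1:ℝ) - 3 / 4 = 1 / 2 ^ 2 by norm_num,
        show (3:ℝ) / 4 = 3 / 2 ^ 2 by norm_num, Real.log_div (by norm_num) (by norm_num),
        Real.log_div (by norm_num) (by norm_num), Real.log_pow, Real.log_one]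
      push_cast
      ring
    apply main_asymp (3 / 4) ρ 0 3 (by norm_num) (by norm_num) h0 le_rfl
    · intro n
      have := PP_le n ⌊3 / 4 * (n:ℝ)⌋₊ 1 one_pos le_rfl
      simp only [one_pow, mul_one] at this
      refine this.trans (le_of_eq ?_)
      rw [mul_comm, Real.exp_nat_mul, mul_comm, Real.exp_mul, Real.exp_log (by norm_num)]
      norm_num
    · rw [g34]; linarith
    · rw [g34]; linarith
end
end

section
/- Let C be an [n,k] linear code over F_q with n ≥ 2, let C* = {(c_1,…,c_{n−1}) : (c_1,…,c_n) ∈ C} be the code punctured in the last coordinate, and let C̄ = {(c_1,…,c_n, −Σ_{i=1}^n c_i) : (c_1,…,c_n) ∈ C} be the extended code. Then for every t ≥ 1: (i) R_t(C*) ∈ {R_t(C), R_t(C) − 1}; and (ii) R_t(C̄) ∈ {R_t(C), R_t(C) + 1}. -/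
noncomputable section

theorem twt_punct_le {F : Type*} [Field F] {t n : ℕ} (v : Matrix (Fin t) (Fin (n + 1)) F)
    (w : Matrix (Fin t) (Fin n) F) (h : ∀ i j, w i j = v i j.castSucc) : twt w ≤ twt v := by
  unfold twt
  rw [← Set.ncard_image_of_injective _ (Fin.castSucc_injective n)]
  apply Set.ncard_le_ncard _ (Set.toFinite _)
  rintro _ ⟨j, ⟨i, hi⟩, rfl⟩
  exact ⟨i, by rwa [← h]⟩

theorem twt_le_punct {F : Type*} [Field F] {t n : ℕ} (v : Matrix (Fin t) (Fin (n + 1)) F)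
    (w : Matrix (Fin t) (Fin n) F) (h : ∀ i j, w i j = v i j.castSucc) :
    twt v ≤ twt w + 1 := by
  unfold twt
  rw [← Set.ncard_image_of_injective {j : Fin n | ∃ i : Fin t, w i j ≠ 0}
    (Fin.castSucc_injective n)]
  refine le_trans (Set.ncard_le_ncard ?_ (Set.toFinite _)) (Set.ncard_insert_le (Fin.last n) _)
  rintro j ⟨i, hi⟩
  induction j using Fin.lastCases with
  | last => exact Set.mem_insert _ _
  | cast j => exact Set.mem_insert_of_mem _ ⟨j, ⟨i, by rwa [h]⟩, rfl⟩

theorem genCovRad_spec {F : Type*} [Field F] {n : ℕ} (C : Set (Fin n → F)) (hC : C.Nonempty)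
    (t : ℕ) (v : Matrix (Fin t) (Fin n) F) :
    ∃ c : Matrix (Fin t) (Fin n) F, (∀ i, c i ∈ C) ∧ twt (v - c) ≤ genCovRad C t := by
  obtain ⟨x, hx⟩ := hC
  have hne : {r : ℕ | ∀ v : Matrix (Fin t) (Fin n) F,
    ∃ c : Matrix (Fin t) (Fin n) F, (∀ i, c i ∈ C) ∧ v ∈ tBall r c}.Nonempty := by
    refine ⟨n, fun v => ⟨fun _ => x, fun _ => hx, ?_⟩⟩
    show twt _ ≤ n
    unfold twt
    exact (Set.ncard_le_card _).trans (by simp)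
  exact Nat.sInf_mem hne v

theorem genCovRad_le {F : Type*} [Field F] {n : ℕ} (C : Set (Fin n → F))
    (t r : ℕ) (h : ∀ v : Matrix (Fin t) (Fin n) F,
    ∃ c : Matrix (Fin t) (Fin n) F, (∀ i, c i ∈ C) ∧ twt (v - c) ≤ r) : genCovRad C t ≤ r :=
  Nat.sInf_le h

theorem genCovRad_punct {F : Type*} [Field F] {n : ℕ} (D : Set (Fin (n + 1) → F))
    (E : Set (Fin n → F)) (hD : D.Nonempty)
    (h1 : ∀ d ∈ D, (fun j : Fin n => d j.castSucc) ∈ E)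
    (h2 : ∀ e ∈ E, ∃ d ∈ D, ∀ j : Fin n, d j.castSucc = e j) (t : ℕ) :
    genCovRad E t ≤ genCovRad D t ∧ genCovRad D t ≤ genCovRad E t + 1 := by
  have hE : E.Nonempty := hD.imp' _ h1
  constructor
  · apply genCovRad_le
    intro v
    obtain ⟨c, hc, hw⟩ := genCovRad_spec D hD t (fun i => Fin.snoc (v i) (0 : F))
    refine ⟨fun i j => c i j.castSucc, fun i => h1 _ (hc i), le_trans (twt_punct_le _ _ ?_) hw⟩
    intro i j
    show v i j - c i j.castSucc =
      (Fin.snoc (v i) (0 : F) : Fin (n + 1) → F) j.castSucc - c i j.castSucc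
    simp
  · apply genCovRad_le
    intro v
    obtain ⟨c, hc, hw⟩ := genCovRad_spec E hE t (fun i j => v i j.castSucc)
    choose d hd hdc using fun i => h2 _ (hc i)
    refine ⟨d, hd, le_trans (twt_le_punct _ _ ?_) (Nat.add_le_add_right hw 1)⟩
    intro i j
    show v i j.castSucc - c i j = v i j.castSucc - d i j.castSucc
    rw [hdc]

theorem stmt15 {F : Type*} [Field F] [Fintype F] {n k : ℕ} (hn : 1 ≤ n)
    (C : Submodule F (Fin (n + 1) → F)) (hC : Module.finrank F C = k)
    {t : ℕ} (ht : 1 ≤ t) :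
    ((genCovRad {x : Fin n → F | ∃ c ∈ C, x = fun j => c j.castSucc} t
        = genCovRad (C : Set (Fin (n + 1) → F)) t) ∨
      (genCovRad {x : Fin n → F | ∃ c ∈ C, x = fun j => c j.castSucc} t + 1
        = genCovRad (C : Set (Fin (n + 1) → F)) t)) ∧
    ((genCovRad {y : Fin (n + 2) → F | ∃ c ∈ C, y = Fin.snoc c (-∑ i, c i)} t
        = genCovRad (C : Set (Fin (n + 1) → F)) t) ∨
      (genCovRad {y : Fin (n + 2) → F | ∃ c ∈ C, y = Fin.snoc c (-∑ i, c i)} t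
        = genCovRad (C : Set (Fin (n + 1) → F)) t + 1)) := by
  have A := genCovRad_punct (C : Set (Fin (n + 1) → F))
    {x : Fin n → F | ∃ c ∈ C, x = fun j => c j.castSucc} ⟨0, C.zero_mem⟩
    (fun d hd => ⟨d, hd, rfl⟩)
    (by rintro _ ⟨c, hc, rfl⟩; exact ⟨c, hc, fun _ => rfl⟩) t
  have B := genCovRad_punct {y : Fin (n + 2) → F | ∃ c ∈ C, y = Fin.snoc c (-∑ i, c i)}
    (C : Set (Fin (n + 1) → F)) ⟨_, 0, C.zero_mem, rfl⟩
    (by rintro _ ⟨c, hc, rfl⟩; simpa using hc)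
    (fun e he => ⟨_, ⟨e, he, rfl⟩, fun j => by simp⟩) t
  omega
end
end

section
/- Let C be an [n,k] linear code over F_q, let 1 ≤ t ≤ k, let d_t(C) be the t-th generalized Hamming weight of C, and set δ_t = ⌊(d_t(C) − 1)/2⌋. Then δ_t is the largest integer r with the property that for all c, c' ∈ C^t such that the matrix c − c' has rank t, the t-balls B_r^{(t)}(c) and B_r^{(t)}(c') are disjoint. That is: (i) for all c, c' ∈ C^t with rank(c − c') = t, B_{δ_t}^{(t)}(c) ∩ B_{δ_t}^{(t)}(c') = ∅; and (ii) for every integer r > δ_t there exist c, c' ∈ C^t with rank(c − c') = t and B_r^{(t)}(c) ∩ B_r^{(t)}(c') ≠ ∅. -/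
noncomputable section

theorem supp_span_aux {F : Type*} [Field F] {t n : ℕ} (M : Matrix (Fin t) (Fin n) F) :
    {j : Fin n | ∃ v ∈ Submodule.span F (Set.range M.row), v j ≠ 0} =
      {j : Fin n | ∃ i : Fin t, M i j ≠ 0} := by
  ext j
  simp only [Set.mem_ofPred_eq]
  constructor
  · rintro ⟨v, hv, hvj⟩
    by_contra! h
    apply hvj
    have : Submodule.span F (Set.range M.row) ≤
        LinearMap.ker (LinearMap.proj (R := F) (φ := fun _ : Fin n => F) j) := by
      rw [Submodule.span_le]
      rintro _ ⟨i, rfl⟩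
      simpa using h i
    simpa using this hv
  · rintro ⟨i, hi⟩
    exact ⟨M i, Submodule.subset_span ⟨i, rfl⟩, hi⟩

theorem exists_matrix_aux {F : Type*} [Field F] {t n : ℕ} (C' : Submodule F (Fin n → F))
    (h : Module.finrank F C' = t) : ∃ M : Matrix (Fin t) (Fin n) F,
      Submodule.span F (Set.range M.row) = C' := by
  let b := Module.finBasisOfFinrankEq F C' h
  refine ⟨fun i => (b i : Fin n → F), ?_⟩
  have h1 : Set.range (Matrix.row (fun i => (b i : Fin n → F))) = C'.subtype '' Set.range b := by
    rw [← Set.range_comp]; rfl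
  rw [h1, Submodule.span_image, b.span_eq]
  simp

theorem exists_sub_aux {F : Type*} [Field F] {t n : ℕ} (C : Submodule F (Fin n → F))
    (h : t ≤ Module.finrank F C) : ∃ C' : Submodule F (Fin n → F), C' ≤ C ∧
      Module.finrank F C' = t := by
  obtain ⟨f, hf⟩ := exists_linearIndependent_of_le_finrank h
  refine ⟨Submodule.span F (Set.range (fun i => (f i : Fin n → F))), ?_, ?_⟩
  · rw [Submodule.span_le]
    rintro _ ⟨i, rfl⟩
    exact (f i).2
  · have h2 : LinearIndependent F (fun i => (f i : Fin n → F)) :=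
      hf.map' C.subtype (Submodule.ker_subtype C)
    rw [finrank_span_eq_card h2, Fintype.card_fin]

theorem stmt18 {F : Type*} [Field F] [Fintype F] {n k t : ℕ} (ht1 : 1 ≤ t) (htk : t ≤ k)
    (C : Submodule F (Fin n → F)) (hC : Module.finrank F C = k)
    (d : ℕ)
    (hd : d = sInf { s : ℕ | ∃ C' : Submodule F (Fin n → F), C' ≤ C ∧
      Module.finrank F C' = t ∧ Set.ncard {j : Fin n | ∃ v ∈ C', v j ≠ 0} = s }) :
    (∀ c c' : Matrix (Fin t) (Fin n) F, (∀ i, c i ∈ C) → (∀ i, c' i ∈ C) →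
      (c - c').rank = t →
      tBall ((d - 1) / 2) c ∩ tBall ((d - 1) / 2) c' = ∅) ∧
    (∀ r : ℕ, (d - 1) / 2 < r → ∃ c c' : Matrix (Fin t) (Fin n) F,
      (∀ i, c i ∈ C) ∧ (∀ i, c' i ∈ C) ∧ (c - c').rank = t ∧
      (tBall r c ∩ tBall r c').Nonempty) := by
  set S := { s : ℕ | ∃ C' : Submodule F (Fin n → F), C' ≤ C ∧
      Module.finrank F C' = t ∧ Set.ncard {j : Fin n | ∃ v ∈ C', v j ≠ 0} = s } with hS
  have hne : S.Nonempty := by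
    obtain ⟨C', h1, h2⟩ := exists_sub_aux C (hC ▸ htk)
    exact ⟨_, C', h1, h2, rfl⟩
  have hmem : d ∈ S := hd ▸ Nat.sInf_mem hne
  obtain ⟨D, hDC, hDt, hDd⟩ := hmem
  have hdpos : 1 ≤ d := by
    by_contra! h0
    have hd0 : d = 0 := by omega
    rw [hd0, Set.ncard_eq_zero] at hDd
    have : D = ⊥ := by
      rw [Submodule.eq_bot_iff]
      intro v hv
      funext j
      by_contra hj
      have : j ∈ {j : Fin n | ∃ v ∈ D, v j ≠ 0} := ⟨v, hv, hj⟩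
      rw [hDd] at this
      exact this
    rw [this, finrank_bot] at hDt
    omega
  constructor
  · intro c c' hc hc' hr
    rw [Set.eq_empty_iff_forall_notMem]
    rintro v ⟨hv, hv'⟩
    simp only [tBall, Set.mem_ofPred_eq, twt] at hv hv'
    have hle : d ≤ Set.ncard {j : Fin n | ∃ i : Fin t, (c - c') i j ≠ 0} := by
      rw [hd]
      apply Nat.sInf_le
      refine ⟨Submodule.span F (Set.range (c - c').row), ?_, ?_, ?_⟩
      · rw [Submodule.span_le]
        rintro _ ⟨i, rfl⟩
        exact C.sub_mem (hc i) (hc' i)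
      · rw [← Matrix.rank_eq_finrank_span_row, hr]
      · rw [supp_span_aux]
    have hsub : {j : Fin n | ∃ i : Fin t, (c - c') i j ≠ 0} ⊆
        {j : Fin n | ∃ i : Fin t, (v - c) i j ≠ 0} ∪
        {j : Fin n | ∃ i : Fin t, (v - c') i j ≠ 0} := by
      rintro j ⟨i, hi⟩
      by_contra hcon
      simp only [Set.mem_union, Set.mem_ofPred_eq, not_or, not_exists, not_not,
        Matrix.sub_apply] at hcon hi
      apply hi
      linear_combination hcon.2 i - hcon.1 i
    have h1 := Set.ncard_le_ncard hsub (Set.toFinite _)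
    have h2 := Set.ncard_union_le {j : Fin n | ∃ i : Fin t, (v - c) i j ≠ 0}
        {j : Fin n | ∃ i : Fin t, (v - c') i j ≠ 0}
    omega
  · intro r hr
    obtain ⟨M, hM⟩ := exists_matrix_aux D hDt
    have hMd : Set.ncard {j : Fin n | ∃ i : Fin t, M i j ≠ 0} = d := by
      rw [← supp_span_aux, hM, hDd]
    obtain ⟨T, hT, hTc⟩ := Set.exists_subset_card_eq
      (s := {j : Fin n | ∃ i : Fin t, M i j ≠ 0}) (n := min r d) (by rw [hMd]; exact min_le_right _ _)
    refine ⟨M, 0, ?_, fun i => C.zero_mem, ?_, ?_⟩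
    · intro i
      apply hDC
      rw [← hM]
      exact Submodule.subset_span ⟨i, rfl⟩
    · rw [sub_zero, Matrix.rank_eq_finrank_span_row, hM, hDt]
    · classical
      obtain ⟨V, hV⟩ : ∃ V : Matrix (Fin t) (Fin n) F,
          ∀ i j, V i j = if j ∈ T then M i j else 0 :=
        ⟨Matrix.of fun i j => if j ∈ T then M i j else 0, fun i j => rfl⟩
      refine ⟨V, ?_, ?_⟩
      · change Set.ncard _ ≤ r
        have hsub : {j : Fin n | ∃ i : Fin t,
            (V - M) i j ≠ 0} ⊆
            {j : Fin n | ∃ i : Fin t, M i j ≠ 0} \ T := by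
          rintro j ⟨i, hi⟩
          rw [Matrix.sub_apply, hV] at hi
          by_cases hj : j ∈ T
          · simp [hj] at hi
          · simp only [hj, if_false, zero_sub, ne_eq, neg_eq_zero] at hi
            exact ⟨⟨i, hi⟩, hj⟩
        have h1 := Set.ncard_le_ncard hsub (Set.toFinite _)
        rw [Set.ncard_sdiff hT (Set.toFinite _)] at h1
        omega
      · change Set.ncard _ ≤ r
        have hsub : {j : Fin n | ∃ i : Fin t,
            (V - 0) i j ≠ 0} ⊆
            T := by
          rintro j ⟨i, hi⟩
          rw [Matrix.sub_apply, hV] at hi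
          by_contra hj
          simp [hj] at hi
        have h1 := Set.ncard_le_ncard hsub (Set.toFinite _)
        omega
end
end

section
/- Let C be an [n,k,d] linear code over F_q with k ≥ 1 and minimum Hamming distance d ≥ 3. Then the generalized covering-radius hierarchy of C is strictly increasing, i.e., R_1(C) < R_2(C) < ⋯ < R_{n−k}(C) = n−k, if and only if R_1(C) = 1 (equivalently, the Hamming balls of radius 1 centered at the codewords of C partition F_q^n, i.e., C is a perfect single-error-correcting code). -/
noncomputable section

theorem gcr_spec {F : Type*} [Field F] {n : ℕ} (C : Submodule F (Fin n → F)) (t : ℕ)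
    (v : Matrix (Fin t) (Fin n) F) :
    ∃ c : Matrix (Fin t) (Fin n) F, (∀ i, c i ∈ C) ∧
      twt (v - c) ≤ genCovRad (C : Set (Fin n → F)) t := by
  have hne : {r : ℕ | ∀ v : Matrix (Fin t) (Fin n) F,
    ∃ c : Matrix (Fin t) (Fin n) F, (∀ i, c i ∈ (C : Set (Fin n → F))) ∧ v ∈ tBall r c}.Nonempty := by
    refine ⟨n, fun v => ⟨0, fun i => C.zero_mem, ?_⟩⟩
    change Set.ncard _ ≤ n
    refine (Set.ncard_le_ncard (Set.subset_univ _) (Set.toFinite _)).trans ?_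
    simp [Set.ncard_univ]
  exact Nat.sInf_mem hne v

theorem gcr_lower {F : Type*} [Field F] {n : ℕ} (C : Submodule F (Fin n → F)) (t : ℕ)
    (ht : t ≤ n - Module.finrank F C) : t ≤ genCovRad (C : Set (Fin n → F)) t := by
  have hq : Module.finrank F ((Fin n → F) ⧸ C) = n - Module.finrank F C := by
    have := C.finrank_quotient_add_finrank
    simp at this
    omega
  let b := Module.finBasis F ((Fin n → F) ⧸ C)
  have hb : LinearIndependent F (fun i : Fin t => b (Fin.castLE (ht.trans hq.ge) i)) :=
    b.linearIndependent.comp _ (Fin.castLE_injective _)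
  choose v hv using fun i : Fin t => C.mkQ_surjective (b (Fin.castLE (ht.trans hq.ge) i))
  obtain ⟨c, hc, hw⟩ := gcr_spec C t (Matrix.of v)
  refine le_trans ?_ hw
  set w : Matrix (Fin t) (Fin n) F := Matrix.of v - c with hwdef
  have hwi : LinearIndependent F (fun i => w i) := by
    apply LinearIndependent.of_comp C.mkQ
    have hfe : (C.mkQ ∘ fun i => w i) =
        fun i : Fin t => b (Fin.castLE (ht.trans hq.ge) i) := by
      funext i
      have h1 : C.mkQ (c i) = 0 := by simpa using hc i
      have h2 : w i = v i - c i := rfl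
      simp only [Function.comp]
      rw [h2, map_sub, h1, hv, sub_zero]
    rw [hfe]
    exact hb
  let S : Set (Fin n) := {j | ∃ i, w i j ≠ 0}
  have hS : LinearIndependent F (fun i => (fun j : S => w i j)) := by
    classical
    rw [Fintype.linearIndependent_iff] at hwi ⊢
    intro g hg
    apply hwi g
    funext j
    by_cases hj : j ∈ S
    · have := congrFun hg ⟨j, hj⟩
      simpa [Finset.sum_apply] using this
    · have h0 : ∀ i, w i j = 0 := fun i => by
        by_contra h
        exact hj ⟨i, h⟩
      simp [Finset.sum_apply, h0]
  have := hS.fintype_card_le_finrank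
  classical
  rw [Module.finrank_fintype_fun_eq_card, Fintype.card_fin, ← Nat.card_eq_fintype_card] at this
  exact this

theorem gcr_upper {F : Type*} [Field F] {n : ℕ} (C : Submodule F (Fin n → F)) (t : ℕ)
    (h1 : genCovRad (C : Set (Fin n → F)) 1 = 1) : genCovRad (C : Set (Fin n → F)) t ≤ t := by
  apply Nat.sInf_le
  intro v
  have key : ∀ x : Fin n → F, ∃ c ∈ C, Set.ncard {j | x j - c j ≠ 0} ≤ 1 := by
    intro x
    obtain ⟨c, hc, hw⟩ := gcr_spec C 1 (fun _ => x)
    refine ⟨c 0, hc 0, ?_⟩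
    rw [h1] at hw
    refine le_trans (le_of_eq ?_) hw
    unfold twt
    congr 1
    ext j
    simp only [Set.mem_ofPred_eq, Fin.exists_fin_one]
    rfl
  choose c hc hw using fun i => key (v i)
  refine ⟨c, hc, ?_⟩
  change Set.ncard {j | ∃ i, v i j - c i j ≠ 0} ≤ t
  have he : {j | ∃ i, v i j - c i j ≠ 0} = ⋃ i, {j | v i j - c i j ≠ 0} := by
    ext j
    simp
  rw [he]
  calc _ ≤ ∑ i : Fin t, Set.ncard {j | v i j - c i j ≠ 0} := Set.ncard_iUnion_le_of_fintype _
    _ ≤ ∑ i : Fin t, 1 := Finset.sum_le_sum fun i _ => hw i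
    _ = t := by simp

theorem stmt19 {F : Type*} [Field F] [Fintype F] [DecidableEq F] {n k d : ℕ}
    (hk : 1 ≤ k) (hd : 3 ≤ d)
    (C : Submodule F (Fin n → F)) (hC : Module.finrank F C = k)
    (hdist : ∀ x ∈ C, ∀ y ∈ C, x ≠ y → d ≤ hammingDist x y)
    (hex : ∃ x ∈ C, ∃ y ∈ C, x ≠ y ∧ hammingDist x y = d) :
    ((∀ t : ℕ, 1 ≤ t → t + 1 ≤ n - k →
        genCovRad (C : Set (Fin n → F)) t < genCovRad (C : Set (Fin n → F)) (t + 1)) ∧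
      genCovRad (C : Set (Fin n → F)) (n - k) = n - k)
      ↔ genCovRad (C : Set (Fin n → F)) 1 = 1 := by
  have hnk : 1 ≤ n - k := by
    by_contra hcon
    have hle : k ≤ n := by
      have := C.finrank_le
      simpa [hC] using this
    have hkn : k = n := by omega
    have htop : C = ⊤ := Submodule.eq_top_of_finrank_eq (by simp [hC, hkn])
    have hn : 0 < n := by omega
    have hx := hdist (Pi.single ⟨0, hn⟩ 1) (by simp [htop]) 0 C.zero_mem (by simp)
    have : hammingDist (Pi.single ⟨0, hn⟩ 1 : Fin n → F) 0 ≤ 1 := by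
      rw [hammingDist_zero_right, hammingNorm]
      refine Finset.card_le_one.2 ?_
      intro a ha b hb
      simp [Pi.single_apply] at ha hb
      rw [ha, hb]
    omega
  constructor
  · rintro ⟨hs, he⟩
    have hch : ∀ t, 1 ≤ t → t ≤ n - k →
        genCovRad (C : Set (Fin n → F)) 1 + t ≤ genCovRad (C : Set (Fin n → F)) t + 1 := by
      intro t ht
      induction t, ht using Nat.le_induction with
      | base => intro _; exact le_rfl
      | succ t ht ih =>
        intro h
        have h2 := ih (by omega)
        have h3 := hs t ht h
        omega
    have h1 := hch (n - k) hnk le_rfl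
    have h2 := gcr_lower C 1 (by omega)
    omega
  · intro h1
    have heq : ∀ t, t ≤ n - k → genCovRad (C : Set (Fin n → F)) t = t := fun t ht =>
      le_antisymm (gcr_upper C t h1) (gcr_lower C t (by omega))
    refine ⟨fun t _ ht => ?_, heq _ le_rfl⟩
    rw [heq t (by omega), heq (t + 1) ht]
    omega
end
end
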